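/- arXiv:math/0005204 — 4 statements merged into one kernel-verified Lean document; each statement's English description precedes it below -/
import Mathlib

section
/- Let f₁,…,fₙ ∈ ℝ[x₁,…,xₙ] and suppose that at every common root of f₁,…,fₙ in ℂⁿ the Jacobian determinant det(∂f_i/∂x_j) is nonzero. Let k' be the number of distinct exponent vectors that appear in a monomial of at least one of f₁,…,fₙ. Then the number of common roots of f₁,…,fₙ lying in the positive orthant {(x₁,…,xₙ) ∈ ℝⁿ : x_i > 0 for all i} is at most (n+1)^{k'}·2^{k'(k'−1)/2}. -/
open MvPolynomial Set Filter Topology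

/-- A zero of `Φ` at which the derivative of `Φ` is injective. -/
def IsNondegZero {E F : Type*} [NormedAddCommGroup E] [NormedSpace ℝ E] [NormedAddCommGroup F]
    [NormedSpace ℝ F] (Φ : E → F) (x : E) : Prop :=
  Φ x = 0 ∧ Function.Injective (fderiv ℝ Φ x)

/-- `Φ` has at most `B` nondegenerate zeros. -/
def NondegZerosLE {E F : Type*} [NormedAddCommGroup E] [NormedSpace ℝ E] [NormedAddCommGroup F]
    [NormedSpace ℝ F] (Φ : E → F) (B : ℕ) : Prop :=
  ∀ T : Finset E, (∀ p ∈ T, IsNondegZero Φ p) → T.card ≤ B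

/-- Inverse function theorem in finite dimension: near a point with injective derivative, a
`C¹` map is a homeomorphism whose inverse is differentiable at the image point. -/
lemma exists_openPartialHomeomorph {E : Type*} [NormedAddCommGroup E] [NormedSpace ℝ E]
    [FiniteDimensional ℝ E] {Φ : E → E} (hΦ : ContDiff ℝ 1 Φ) {q : E}
    (hq : Function.Injective (fderiv ℝ Φ q)) :
    ∃ e : OpenPartialHomeomorph E E, q ∈ e.source ∧ (∀ x, e x = Φ x) ∧
      ∃ L : E →L[ℝ] E, HasFDerivAt e.symm L (Φ q) ∧ ∀ v, fderiv ℝ Φ q (L v) = v := by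
  have := FiniteDimensional.complete ℝ E
  let f' : E ≃L[ℝ] E :=
    (LinearEquiv.ofInjectiveEndo (fderiv ℝ Φ q : E →ₗ[ℝ] E) hq).toContinuousLinearEquiv
  have hf' : HasFDerivAt Φ (f' : E →L[ℝ] E) q := by
    have h1 := (hΦ.differentiable (by simp) q).hasFDerivAt
    exact h1.congr_fderiv (ContinuousLinearMap.ext fun v => rfl)
  have hs := hΦ.contDiffAt.hasStrictFDerivAt' (x := q) hf' (by simp)
  refine ⟨hs.toOpenPartialHomeomorph Φ, hs.mem_toOpenPartialHomeomorph_source, fun x => rfl,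
    (f'.symm : E →L[ℝ] E), hs.to_localInverse.hasFDerivAt, fun v => ?_⟩
  exact f'.apply_symm_apply v

lemma hasFDerivAt_eval {σ : Type*} [Fintype σ] (p : MvPolynomial σ ℝ) (x : σ → ℝ) :
    HasFDerivAt (fun y : σ → ℝ => eval y p)
      (∑ j, eval x (pderiv j p) • (ContinuousLinearMap.proj j : (σ → ℝ) →L[ℝ] ℝ)) x := by
  classical
  induction p using MvPolynomial.induction_on with
  | C a => simpa using hasFDerivAt_const a x
  | add p q hp hq =>
    simp only [map_add, add_smul, Finset.sum_add_distrib]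
    exact hp.add hq
  | mul_X p i hp =>
    have h := hp.fun_mul (hasFDerivAt_apply (𝕜 := ℝ) i x)
    simp only [map_mul, eval_X]
    refine h.congr_fderiv ?_
    ext v
    simp [pderiv_X, Pi.single_apply, add_mul, Finset.sum_add_distrib, Finset.mul_sum,
      apply_ite, mul_assoc]

lemma contDiff_eval {σ : Type*} [Fintype σ] (p : MvPolynomial σ ℝ) {n : WithTop ℕ∞} :
    ContDiff ℝ n (fun y : σ → ℝ => eval y p) := by
  induction p using MvPolynomial.induction_on with
  | C a => simpa using contDiff_const
  | add p q hp hq => simpa using hp.add hq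
  | mul_X p i hp => simpa using hp.mul (contDiff_apply ℝ ℝ i)

lemma totalDegree_pderiv_le {σ : Type*} (j : σ) (p : MvPolynomial σ ℝ) :
    (pderiv j p).totalDegree ≤ p.totalDegree - 1 := by
  classical
  conv_lhs => rw [p.as_sum, map_sum]
  refine totalDegree_finsetSum_le fun s hs => ?_
  rw [pderiv_monomial]
  by_cases h : s j = 0
  · simp [h]
  refine (totalDegree_monomial_le _ _).trans ?_
  have h1 : (s.sum fun _ e => e) ≤ p.totalDegree := le_totalDegree hs
  have h2 : s = (s - Finsupp.single j 1) + Finsupp.single j 1 := by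
    refine (tsub_add_cancel_of_le ?_).symm
    simpa [Finsupp.single_le_iff] using Nat.one_le_iff_ne_zero.2 h
  rw [h2, Finsupp.sum_add_index' (by simp) (by simp)] at h1
  rw [Finsupp.sum_single_index rfl] at h1
  exact Nat.le_sub_of_add_le h1

/-- Polynomials separating the points of a finite set. -/
lemma exists_interpolation {σ : Type*} (T : Finset (σ → ℝ)) (z : σ → ℝ) :
    ∃ h : MvPolynomial σ ℝ, eval z h = 1 ∧ ∀ z' ∈ T, z' ≠ z → eval z' h = 0 := by
  classical
  have key : ∀ z' : σ → ℝ, ∃ h : MvPolynomial σ ℝ, eval z h = 1 ∧ (z' ≠ z → eval z' h = 0) := by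
    intro z'
    by_cases hz : z' = z
    · exact ⟨1, by simp, fun h => (h hz).elim⟩
    obtain ⟨i, hi⟩ := Function.ne_iff.1 hz
    have hi' : z i - z' i ≠ 0 := sub_ne_zero.2 (Ne.symm hi)
    exact ⟨C (z i - z' i)⁻¹ * (X i - C (z' i)), by simp [hi'], by simp⟩
  choose h h1 h0 using key
  refine ⟨∏ z' ∈ T, h z', ?_, fun w hw hne => ?_⟩
  · rw [map_prod]; exact Finset.prod_eq_one fun w _ => h1 w
  · rw [map_prod]; exact Finset.prod_eq_zero hw (h0 w hne)

/-- Products of monomials in a local coordinate system `Φ` with functions separating the points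
of `T` are linearly independent. -/
lemma coeff_eq_zero_of_local_sections {σ : Type*} [Fintype σ] [DecidableEq (σ → ℝ)]
    {Φ : (σ → ℝ) → σ → ℝ} {T : Finset (σ → ℝ)}
    (hs : ∀ z ∈ T, ∃ s : (σ → ℝ) → σ → ℝ, ContinuousAt s 0 ∧ s 0 = z ∧ ∀ᶠ y in 𝓝 0, Φ (s y) = y)
    {h : (σ → ℝ) → (σ → ℝ) → ℝ} (hcont : ∀ z, Continuous (h z))
    (hh : ∀ z ∈ T, ∀ z' ∈ T, h z z' = if z = z' then 1 else 0)
    (A : Finset (σ → ℕ)) (c : (σ → ℕ) → (σ → ℝ) → ℝ)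
    (hc : ∀ x, ∑ a ∈ A, ∑ z ∈ T, c a z * ((∏ r, Φ x r ^ a r) * h z x) = 0) :
    ∀ a ∈ A, ∀ z ∈ T, c a z = 0 := by
  classical
  suffices H : ∀ m : ℕ, ∀ a ∈ A, ∑ r, a r = m → ∀ z ∈ T, c a z = 0 from
    fun a ha => H _ a ha rfl
  intro m
  induction m using Nat.strong_induction_on with
  | _ m IH =>
  intro a₀ ha₀ hm z₀ hz₀
  obtain ⟨s, hs0, hsz, hsΦ⟩ := hs z₀ hz₀
  let Q : MvPolynomial σ ℝ :=
    ∑ a ∈ A with ∑ r, a r = m, monomial (Finsupp.equivFunOnFinite.symm a) (c a z₀)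
  have hQ : Q = 0 := by
    refine MvPolynomial.funext fun w => ?_
    let ψ : ℝ → ℝ := fun τ => ∑ a ∈ A, ∑ z ∈ T,
      c a z * (τ ^ (∑ r, a r - m) * (∏ r, w r ^ a r) * h z (s (τ • w)))
    have hw : Tendsto (fun τ : ℝ => τ • w) (𝓝 0) (𝓝 0) := by
      have : Continuous fun τ : ℝ => τ • w := by fun_prop
      simpa using this.tendsto 0
    have hsw : ContinuousAt (fun τ : ℝ => s (τ • w)) 0 :=
      ContinuousAt.comp_of_eq hs0 (by fun_prop) (by simp)
    have hψc : ContinuousAt ψ 0 := by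
      refine tendsto_finsetSum _ fun a _ => tendsto_finsetSum _ fun z _ => ?_
      refine ContinuousAt.mul continuousAt_const (ContinuousAt.mul (by fun_prop) ?_)
      exact (hcont z).continuousAt.comp hsw
    have hψ0 : ∀ᶠ τ in 𝓝[≠] (0 : ℝ), ψ τ = 0 := by
      filter_upwards [(hw.eventually hsΦ).filter_mono nhdsWithin_le_nhds, self_mem_nhdsWithin]
        with τ hτ hτ0
      have hτ0 : τ ≠ 0 := hτ0
      refine (mul_eq_zero.1 ?_).resolve_left (pow_ne_zero m hτ0)
      rw [← hc (s (τ • w)), Finset.mul_sum]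
      refine Finset.sum_congr rfl fun a ha => ?_
      rw [Finset.mul_sum]
      refine Finset.sum_congr rfl fun z hz => ?_
      rcases lt_or_ge (∑ r, a r) m with hlt | hge
      · simp [IH _ hlt a ha rfl z hz]
      · rw [hτ]
        simp only [Pi.smul_apply, smul_eq_mul, mul_pow, Finset.prod_mul_distrib,
          Finset.prod_pow_eq_pow_sum]
        have : τ ^ (∑ r, a r) = τ ^ m * τ ^ (∑ r, a r - m) := by
          rw [← pow_add, Nat.add_sub_cancel' hge]
        rw [this]; ring
    have hlim : ψ 0 = 0 :=
      tendsto_nhds_unique (hψc.tendsto.mono_left nhdsWithin_le_nhds)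
        (tendsto_const_nhds.congr' (hψ0.mono fun _ h => h.symm))
    rw [map_zero, ← hlim]
    simp only [Q, map_sum, ψ, zero_smul, hsz]
    rw [Finset.sum_filter]
    refine Finset.sum_congr rfl fun a ha => ?_
    rw [Finset.sum_eq_single_of_mem z₀ hz₀ (fun z hz hne => by simp [hh z hz z₀ hz₀, hne]),
      hh z₀ hz₀ z₀ hz₀]
    rcases lt_trichotomy (∑ r, a r) m with hlt | heq | hgt
    · simp [IH _ hlt a ha rfl z₀ hz₀]
    · simp [heq, eval_monomial, Finsupp.prod_fintype]
    · have : ∑ r, a r - m ≠ 0 := by omega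
      simp [hgt.ne', this]
  have hcoef := congrArg (coeff (Finsupp.equivFunOnFinite.symm a₀)) hQ
  simp only [Q, coeff_sum, coeff_monomial, coeff_zero] at hcoef
  rw [Finset.sum_eq_single a₀] at hcoef
  · simpa using hcoef
  · intro b _ hne
    simp [hne]
  · intro hn
    exact absurd (Finset.mem_filter.2 ⟨ha₀, hm⟩) hn

/-- A sequence of polynomial growth cannot grow geometrically along an arithmetic progression. -/
lemma le_of_mul_le_mul_shift {u : ℕ → ℕ} {n S M C : ℕ} (h0 : 1 ≤ u 0)
    (hu : ∀ N, u N ≤ (N + 1) ^ n) (h : ∀ D, S * u D ≤ M * u (D + C)) : S ≤ M := by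
  by_contra! hlt
  rcases Nat.eq_zero_or_pos M with rfl | hM
  · have := h 0
    simp only [Nat.zero_mul, Nat.le_zero, mul_eq_zero] at this
    omega
  have hM' : (0 : ℝ) < M := by exact_mod_cast hM
  set r : ℝ := S / M with hr
  have hr1 : 1 < r := by rw [hr, one_lt_div hM']; exact_mod_cast hlt
  have hgrow : ∀ m : ℕ, r ^ m ≤ u (m * C) := by
    intro m
    induction m with
    | zero => simpa using h0
    | succ m ih =>
      have h1 : (S : ℝ) * u (m * C) ≤ M * u (m * C + C) := by exact_mod_cast h (m * C)
      calc r ^ (m + 1) = r * r ^ m := by ring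
        _ ≤ r * u (m * C) := by gcongr
        _ = S * u (m * C) / M := by rw [hr]; ring
        _ ≤ u (m * C + C) := by rw [div_le_iff₀ hM']; linarith
        _ = u ((m + 1) * C) := by rw [Nat.succ_mul]
  have hlim := (tendsto_pow_const_div_const_pow_of_one_lt n hr1).const_mul (((C : ℝ) + 1) ^ n * r)
  rw [mul_zero] at hlim
  obtain ⟨m, hm⟩ := (((tendsto_add_atTop_iff_nat 1).2 hlim).eventually
    (gt_mem_nhds (zero_lt_one' ℝ))).exists
  have hrm : 0 < r ^ m := by positivity
  have h2 : r ^ m ≤ ((C : ℝ) + 1) ^ n * ((m : ℝ) + 1) ^ n := by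
    refine (hgrow m).trans ?_
    have : (u (m * C) : ℝ) ≤ ((m : ℝ) * C + 1) ^ n := by exact_mod_cast hu (m * C)
    refine this.trans ?_
    rw [← mul_pow]
    gcongr
    nlinarith [(Nat.cast_nonneg m : (0 : ℝ) ≤ m), (Nat.cast_nonneg C : (0 : ℝ) ≤ C)]
  have h3 : ((C : ℝ) + 1) ^ n * r * (((m + 1 : ℕ) : ℝ) ^ n / r ^ (m + 1))
      = ((C : ℝ) + 1) ^ n * ((m : ℝ) + 1) ^ n / r ^ m := by
    push_cast
    rw [pow_succ r m]
    field_simp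
  rw [h3, div_lt_one hrm] at hm
  linarith

/-- Exponent vectors of weighted degree at most `N`. -/
def weightedSimplex {σ : Type*} [Fintype σ] [DecidableEq σ] (d : σ → ℕ) (N : ℕ) :
    Finset (σ → ℕ) :=
  (Fintype.piFinset fun _ => Finset.range (N + 1)).filter fun a => ∑ r, a r * d r ≤ N

lemma mem_weightedSimplex {σ : Type*} [Fintype σ] [DecidableEq σ] {d : σ → ℕ}
    (hd : ∀ r, 1 ≤ d r) {N : ℕ} {a : σ → ℕ} :
    a ∈ weightedSimplex d N ↔ ∑ r, a r * d r ≤ N := by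
  simp only [weightedSimplex, Finset.mem_filter, Fintype.mem_piFinset, Finset.mem_range,
    and_iff_right_iff_imp]
  intro h r
  have h1 := Finset.single_le_sum (f := fun r => a r * d r) (fun _ _ => Nat.zero_le _)
    (Finset.mem_univ r)
  have h2 := Nat.le_mul_of_pos_right (a r) (hd r)
  exact Nat.lt_succ_of_le (h2.trans (h1.trans h))

lemma card_simplex_le {σ : Type*} [Fintype σ] [DecidableEq σ] {d : σ → ℕ}
    (hd : ∀ r, 1 ≤ d r) (N : ℕ) :
    (weightedSimplex (fun _ : σ => 1) N).card ≤ (∏ r, d r) * (weightedSimplex d N).card := by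
  refine Finset.card_le_mul_card_image_of_maps_to (f := fun a r => a r / d r) ?_ _ ?_
  · intro a ha
    rw [mem_weightedSimplex (fun _ => le_rfl)] at ha
    rw [mem_weightedSimplex hd]
    exact (Finset.sum_le_sum fun r _ => by simpa using Nat.div_mul_le_self (a r) (d r)).trans ha
  · intro b _
    calc _ ≤ (Fintype.piFinset fun r => Finset.Ico (b r * d r) ((b r + 1) * d r)).card := by
          refine Finset.card_le_card fun a ha => ?_
          rw [Finset.mem_filter] at ha
          rw [Fintype.mem_piFinset]
          intro r
          rw [← ha.2, Finset.mem_Ico]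
          exact ⟨Nat.div_mul_le_self _ _, (Nat.div_lt_iff_lt_mul (hd r)).1 (Nat.lt_succ_self _)⟩
      _ = ∏ r, d r := by
          rw [Fintype.card_piFinset]
          refine Finset.prod_congr rfl fun r _ => ?_
          rw [Nat.card_Ico, Nat.succ_mul, Nat.add_sub_cancel_left]

lemma card_mul_card_weightedSimplex_le {σ : Type*} [Fintype σ] [DecidableEq σ]
    (P : σ → MvPolynomial σ ℝ) {d : σ → ℕ} (hd : ∀ r, (P r).totalDegree ≤ d r)
    (hd1 : ∀ r, 1 ≤ d r) (T : Finset (σ → ℝ))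
    (hT : ∀ p ∈ T, IsNondegZero (fun x r => eval x (P r)) p) :
    ∃ C, ∀ N, T.card * (weightedSimplex d N).card
      ≤ (weightedSimplex (fun _ : σ => 1) (N + C)).card := by
  classical
  choose h h1 h0 using exists_interpolation T
  set Φ : (σ → ℝ) → σ → ℝ := fun x r => eval x (P r) with hΦ
  have hΦc : ContDiff ℝ 1 Φ := contDiff_pi.2 fun r => contDiff_eval (P r)
  refine ⟨∑ z ∈ T, (h z).totalDegree, fun N => ?_⟩
  set C := ∑ z ∈ T, (h z).totalDegree with hC
  let A := weightedSimplex d N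
  let B := weightedSimplex (fun _ : σ => 1) (N + C)
  let term : A × T → MvPolynomial σ ℝ := fun i => (∏ r, P r ^ i.1.1 r) * h i.2.1
  let L : (A × T → ℝ) →ₗ[ℝ] MvPolynomial σ ℝ := Fintype.linearCombination ℝ term
  let K : (A × T → ℝ) →ₗ[ℝ] (B → ℝ) :=
    (LinearMap.pi fun b : B => MvPolynomial.lcoeff ℝ (Finsupp.equivFunOnFinite.symm b.1)) ∘ₗ L
  have hdeg : ∀ i, (term i).totalDegree ≤ N + C := by
    intro i
    refine (totalDegree_mul _ _).trans (add_le_add ?_ ?_)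
    · refine (totalDegree_finsetProd _ _).trans (le_trans ?_ ((mem_weightedSimplex hd1).1 i.1.2))
      exact Finset.sum_le_sum fun r _ => (totalDegree_pow _ _).trans
        (Nat.mul_le_mul_left _ (hd r))
    · exact Finset.single_le_sum (f := fun z => (h z).totalDegree) (fun _ _ => Nat.zero_le _) i.2.2
  have hK : Function.Injective K := by
    rw [← LinearMap.ker_eq_bot, LinearMap.ker_eq_bot']
    intro c hc
    have hL : L c = 0 := by
      ext b
      rw [coeff_zero]
      by_cases hb : ∑ r, b r ≤ N + C
      · have := congrFun hc ⟨b, (mem_weightedSimplex fun _ => le_rfl).2 (by simpa using hb)⟩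
        simpa [K] using this
      · refine coeff_eq_zero_of_totalDegree_lt ?_
        have : (L c).totalDegree ≤ N + C := by
          simp only [L, Fintype.linearCombination_apply]
          exact totalDegree_finsetSum_le fun i _ => (totalDegree_smul_le _ _).trans (hdeg i)
        refine this.trans_lt ?_
        push Not at hb
        rwa [Finset.sum_subset (Finset.subset_univ b.support) (by simp)]
    let c' : (σ → ℕ) → (σ → ℝ) → ℝ := fun a z =>
      if ha : a ∈ A then if hz : z ∈ T then c (⟨a, ha⟩, ⟨z, hz⟩) else 0 else 0
    have key := coeff_eq_zero_of_local_sections (Φ := Φ) (T := T) (h := fun z x => eval x (h z))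
      ?_ (fun z => (contDiff_eval (n := 0) (h z)).continuous) ?_ A c' ?_
    · ext ⟨a, z⟩
      have := key a a.2 z z.2
      simpa [c'] using this
    · intro z hz
      obtain ⟨e, hes, he, L', hL', -⟩ := exists_openPartialHomeomorph hΦc (hT z hz).2
      have hz0 : Φ z = 0 := (hT z hz).1
      rw [hz0] at hL'
      have hez : e z = 0 := (he z).trans hz0
      refine ⟨e.symm, hL'.continuousAt, ?_, ?_⟩
      · rw [← hez, e.left_inv hes]
      · filter_upwards [e.open_target.mem_nhds (hez ▸ e.map_source hes)] with y hy
        rw [← he, e.right_inv hy]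
    · intro z hz z' hz'
      by_cases hzz : z = z'
      · subst hzz; simp [h1]
      · simp [hzz, h0 z z' hz' (Ne.symm hzz)]
    · intro x
      have := congrArg (eval x) hL
      rw [map_zero] at this
      rw [← this]
      simp only [L, Fintype.linearCombination_apply, map_sum, Fintype.sum_prod_type, term,
        smul_eval, map_mul, map_prod, map_pow]
      rw [← Finset.sum_coe_sort A]
      refine Finset.sum_congr rfl fun a _ => ?_
      rw [← Finset.sum_coe_sort T]
      exact Finset.sum_congr rfl fun z _ => by simp [c', Φ]
  have := LinearMap.finrank_le_finrank_of_injective hK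
  simpa [Module.finrank_fintype_fun_eq_card, mul_comm, A, B] using this

/-- **Bézout's inequality** for the nondegenerate real zeros of a square polynomial system. -/
theorem nondegZerosLE_eval {σ : Type*} [Fintype σ] [DecidableEq σ]
    (P : σ → MvPolynomial σ ℝ) {d : σ → ℕ} (hd : ∀ r, (P r).totalDegree ≤ d r)
    (hd1 : ∀ r, 1 ≤ d r) :
    NondegZerosLE (fun x r => eval x (P r)) (∏ r, d r) := by
  intro T hT
  obtain ⟨C, hC⟩ := card_mul_card_weightedSimplex_le P hd hd1 T hT
  refine le_of_mul_le_mul_shift (u := fun N => (weightedSimplex (fun _ : σ => 1) N).card)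
    (n := Fintype.card σ) (C := C) ?_ ?_ ?_
  · exact Finset.card_pos.2 ⟨0, (mem_weightedSimplex fun _ => le_rfl).2 (by simp)⟩
  · intro N
    refine (Finset.card_filter_le _ _).trans ?_
    simp
  · intro D
    calc _ ≤ T.card * ((∏ r, d r) * (weightedSimplex d D).card) :=
          Nat.mul_le_mul_left _ (card_simplex_le hd1 D)
      _ = (∏ r, d r) * (T.card * (weightedSimplex d D).card) := by ring
      _ ≤ _ := Nat.mul_le_mul_left _ (hC D)

/-- `X` lifts the ray `t ↦ t • v` through `Φ` over the set `I` of times, starting at `p` and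
staying in `U`. -/
structure IsRayLift {E : Type*} [NormedAddCommGroup E] [NormedSpace ℝ E] (Φ : E → E) (U : Set E)
    (p v : E) (X : ℝ → E) (I : Set ℝ) : Prop where
  zero : X 0 = p
  cont : ContinuousOn X I
  mem : ∀ t ∈ I, X t ∈ U
  map : ∀ t ∈ I, Φ (X t) = t • v

section RayLift

variable {E : Type*} [NormedAddCommGroup E] [NormedSpace ℝ E]

lemma IsRayLift.mono {Φ : E → E} {U : Set E} {p v : E} {X : ℝ → E} {I I' : Set ℝ}
    (h : IsRayLift Φ U p v X I) (hI : I' ⊆ I) : IsRayLift Φ U p v X I' :=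
  ⟨h.zero, h.cont.mono hI, fun t ht => h.mem t (hI ht), fun t ht => h.map t (hI ht)⟩

variable [FiniteDimensional ℝ E]

lemma IsRayLift.eqOn {Φ : E → E} (hΦ : ContDiff ℝ 1 Φ) {U : Set E}
    (hU : ∀ x ∈ U, Function.Injective (fderiv ℝ Φ x)) {p p' v : E} {X Y : ℝ → E} {I : Set ℝ}
    (hI : I.OrdConnected) (hX : IsRayLift Φ U p v X I) (hY : IsRayLift Φ U p' v Y I)
    {t₀ : ℝ} (ht₀ : t₀ ∈ I) (h : X t₀ = Y t₀) : EqOn X Y I := by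
  have : PreconnectedSpace I := isPreconnected_iff_preconnectedSpace.1 hI.isPreconnected
  let f : U → E := fun x => Φ x
  have hsep : IsSeparatedMap f := T2Space.isSeparatedMap f
  have hinj : IsLocallyInjective f := by
    intro x
    obtain ⟨e, hes, he, -⟩ := exists_openPartialHomeomorph hΦ (hU x x.2)
    refine ⟨Subtype.val ⁻¹' e.source, e.open_source.preimage continuous_subtype_val, hes, ?_⟩
    intro a ha b hb hab
    refine Subtype.ext (e.injOn ha hb ?_)
    rw [he, he]; exact hab
  have := hsep.eq_of_comp_eq hinj (A := I) (g₁ := fun t => ⟨X t, hX.mem t t.2⟩)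
    (g₂ := fun t => ⟨Y t, hY.mem t t.2⟩)
    ((continuousOn_iff_continuous_domRestrict.1 hX.cont).subtype_mk _)
    ((continuousOn_iff_continuous_domRestrict.1 hY.cont).subtype_mk _)
    (by ext t; simp [f, hX.map t t.2, hY.map t t.2]) ⟨t₀, ht₀⟩ (Subtype.ext h)
  intro t ht
  exact congrArg Subtype.val (congrFun this ⟨t, ht⟩)

lemma IsRayLift.exists_extend {Φ : E → E} (hΦ : ContDiff ℝ 1 Φ) {U : Set E} (hUo : IsOpen U)
    (hU : ∀ x ∈ U, Function.Injective (fderiv ℝ Φ x)) {p v q : E} (hq : q ∈ U) {T : ℝ}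
    (hqT : Φ q = T • v) :
    ∃ V ∈ 𝓝 q, ∃ δ > 0, ∀ t₀, 0 ≤ t₀ → |t₀ - T| < δ → ∀ X, IsRayLift Φ U p v X (Icc 0 t₀) →
      X t₀ ∈ V → ∀ b, t₀ ≤ b → b < T + δ → ∃ Y, IsRayLift Φ U p v Y (Icc 0 b) := by
  obtain ⟨e, hes, he, -⟩ := exists_openPartialHomeomorph hΦ (hU q hq)
  have heq : e q = T • v := (he q).trans hqT
  have hT : T • v ∈ e.target := heq ▸ e.map_source hes
  have hsymm : ContinuousAt e.symm (T • v) := e.continuousAt_symm hT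
  have hev : ∀ᶠ y in 𝓝 (T • v), y ∈ e.target ∧ e.symm y ∈ U := by
    refine (e.open_target.eventually_mem hT).and (hsymm.eventually_mem (hUo.mem_nhds ?_))
    rwa [← heq, e.left_inv hes]
  have hc : Continuous fun t : ℝ => t • v := by fun_prop
  obtain ⟨δ, hδ, hball⟩ := Metric.eventually_nhds_iff.1 (hc.continuousAt.eventually hev)
  refine ⟨e.source, e.open_source.mem_nhds hes, δ, hδ, fun t₀ h0 ht₀ X hX hXs b hb hbT => ?_⟩
  have hnear : ∀ t ∈ Icc t₀ b, t • v ∈ e.target ∧ e.symm (t • v) ∈ U := fun t ht => by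
    refine hball ?_
    rw [Real.dist_eq]
    have := abs_lt.1 ht₀
    exact abs_lt.2 ⟨by linarith [ht.1], by linarith [ht.2]⟩
  have hmatch : X t₀ = e.symm (t₀ • v) := by
    rw [← hX.map t₀ ⟨h0, le_rfl⟩, ← he, e.left_inv hXs]
  let Y : ℝ → E := fun t => if t ≤ t₀ then X t else e.symm (t • v)
  have hY1 : ∀ t ∈ Icc 0 t₀, Y t = X t := fun t ht => if_pos ht.2
  have hY2 : ∀ t ∈ Icc t₀ b, Y t = e.symm (t • v) := fun t ht => by
    rcases eq_or_lt_of_le ht.1 with rfl | h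
    · simp [Y, hmatch]
    · exact if_neg (not_le.2 h)
  have hI : Icc 0 b = Icc 0 t₀ ∪ Icc t₀ b := (Icc_union_Icc_eq_Icc h0 hb).symm
  refine ⟨Y, (hY1 0 ⟨le_rfl, h0⟩).trans hX.zero, ?_, fun t ht => ?_, fun t ht => ?_⟩
  · rw [hI]
    refine ContinuousOn.union_of_isClosed (hX.cont.congr hY1) (ContinuousOn.congr ?_ hY2)
      isClosed_Icc isClosed_Icc
    exact e.continuousOn_symm.comp hc.continuousOn fun t ht => (hnear t ht).1
  · rw [hI] at ht
    rcases ht with ht | ht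
    · rw [hY1 t ht]; exact hX.mem t ht
    · rw [hY2 t ht]; exact (hnear t ht).2
  · rw [hI] at ht
    rcases ht with ht | ht
    · rw [hY1 t ht]; exact hX.map t ht
    · rw [hY2 t ht, ← he, e.right_inv (hnear t ht).1]

/-- The maximal lift of a ray through a map that is a local diffeomorphism on `U`: it leaves every
compact subset of `U`. -/
theorem exists_maximal_rayLift {Φ : E → E} (hΦ : ContDiff ℝ 1 Φ) {U : Set E} (hUo : IsOpen U)
    (hU : ∀ x ∈ U, Function.Injective (fderiv ℝ Φ x)) {p v : E} (hp : p ∈ U) (hp0 : Φ p = 0)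
    (hv : v ≠ 0) :
    ∃ (X : ℝ → E) (I : Set ℝ), I.OrdConnected ∧ 0 ∈ I ∧ (∀ t ∈ I, 0 ≤ t) ∧
      IsRayLift Φ U p v X I ∧
      (∀ t ∈ I, 0 < t → ∃ w, HasDerivAt X w t ∧ fderiv ℝ Φ (X t) w = v) ∧
      ∀ K ⊆ U, IsCompact K → ∃ t ∈ I, X t ∉ K := by
  let S : Set ℝ := {b | 0 ≤ b ∧ ∃ X, IsRayLift Φ U p v X (Icc 0 b)}
  choose! Z hZ using fun b (hb : b ∈ S) => hb.2
  have hS : ∀ b ∈ S, ∀ t, 0 ≤ t → t ≤ b → t ∈ S := fun b hb t h0 ht =>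
    ⟨h0, Z b, (hZ b hb).mono (Icc_subset_Icc_right ht)⟩
  let X : ℝ → E := fun t => Z t t
  have hXZ : ∀ b ∈ S, EqOn X (Z b) (Icc 0 b) := fun b hb t ht => by
    have htS := hS b hb t ht.1 ht.2
    exact (hZ t htS).eqOn hΦ hU ordConnected_Icc
      ((hZ b hb).mono (Icc_subset_Icc_right ht.2)) (left_mem_Icc.2 ht.1)
      ((hZ t htS).zero.trans (hZ b hb).zero.symm) (right_mem_Icc.2 ht.1)
  have h0S : (0 : ℝ) ∈ S := by
    refine ⟨le_rfl, fun _ => p, rfl, continuousOn_const, fun _ _ => hp, fun t ht => ?_⟩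
    rw [Icc_self, mem_singleton_iff] at ht
    simp [ht, hp0]
  have hlift : ∀ b ∈ S, IsRayLift Φ U p v X (Icc 0 b) := fun b hb =>
    ⟨(hXZ b hb (left_mem_Icc.2 hb.1)).trans (hZ b hb).zero, (hZ b hb).cont.congr (hXZ b hb),
      fun t ht => hXZ b hb ht ▸ (hZ b hb).mem t ht, fun t ht => hXZ b hb ht ▸ (hZ b hb).map t ht⟩
  have hopen : ∀ b ∈ S, ∃ b' ∈ S, b < b' := fun b hb => by
    have hbb := right_mem_Icc.2 hb.1
    obtain ⟨V, hV, δ, hδ, h⟩ := IsRayLift.exists_extend (p := p) hΦ hUo hU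
      ((hlift b hb).mem b hbb) ((hlift b hb).map b hbb)
    obtain ⟨Y, hY⟩ := h b hb.1 (by simpa using hδ) X (hlift b hb) (mem_of_mem_nhds hV)
      (b + δ / 2) (by linarith) (by linarith)
    exact ⟨b + δ / 2, ⟨by linarith [hb.1], Y, hY⟩, by linarith⟩
  have hX : IsRayLift Φ U p v X S := by
    refine ⟨(hlift 0 h0S).zero, fun t ht => ?_, fun t ht => (hlift t ht).mem t ⟨ht.1, le_rfl⟩,
      fun t ht => (hlift t ht).map t ⟨ht.1, le_rfl⟩⟩
    obtain ⟨b, hb, htb⟩ := hopen t ht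
    refine ((hlift b hb).cont t ⟨ht.1, htb.le⟩).mono_of_mem_nhdsWithin ?_
    filter_upwards [self_mem_nhdsWithin, mem_nhdsWithin_of_mem_nhds (Iio_mem_nhds htb)]
      with s hs hsb
    exact ⟨hs.1, le_of_lt hsb⟩
  refine ⟨X, S, ⟨fun a ha b hb t ht => hS b hb t (ha.1.trans ht.1) ht.2⟩, h0S, fun t ht => ht.1,
    hX, fun t ht h0 => ?_, fun K hK hKc => ?_⟩
  · obtain ⟨e, hes, he, L, hL, hLv⟩ := exists_openPartialHomeomorph hΦ (hU _ (hX.mem t ht))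
    obtain ⟨b, hb, htb⟩ := hopen t ht
    have hnhds : Icc 0 b ∈ 𝓝 t := Icc_mem_nhds h0 htb
    have hXc : ContinuousAt X t := (hlift b hb).cont.continuousAt hnhds
    refine ⟨L v, ?_, hLv v⟩
    rw [hX.map t ht] at hL
    have h1 : HasDerivAt (fun s : ℝ => s • v) v t := by
      simpa using (hasDerivAt_id t).smul_const v
    refine (hL.comp_hasDerivAt t h1).congr_of_eventuallyEq ?_
    filter_upwards [hnhds, hXc.eventually_mem (e.open_source.mem_nhds hes)] with s hs hse
    rw [Function.comp_apply, ← (hlift b hb).map s hs, ← he, e.left_inv hse]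
  · by_contra! hcon
    obtain ⟨M, hM⟩ := hKc.exists_bound_of_continuousOn hΦ.continuous.continuousOn
    have hvpos : 0 < ‖v‖ := norm_pos_iff.2 hv
    have hbdd : BddAbove S := ⟨M / ‖v‖, fun t ht => by
      rw [le_div_iff₀ hvpos]
      have := hM _ (hcon t ht)
      rwa [hX.map t ht, norm_smul, Real.norm_of_nonneg ht.1] at this⟩
    obtain ⟨u, -, hu, huS⟩ := exists_seq_tendsto_sSup ⟨0, h0S⟩ hbdd
    obtain ⟨q, hqK, φ, hφ, hq⟩ := hKc.tendsto_subseq fun n => hcon _ (huS n)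
    have hu' := hu.comp hφ.tendsto_atTop
    have hΦq : Φ q = sSup S • v := by
      refine tendsto_nhds_unique ((hΦ.continuous.tendsto q).comp hq) ?_
      refine (hu'.smul_const v).congr fun n => ?_
      simp [hX.map _ (huS (φ n))]
    obtain ⟨V, hV, δ, hδ, h⟩ := IsRayLift.exists_extend (p := p) hΦ hUo hU (hK hqK) hΦq
    obtain ⟨n, hn1, hn2⟩ := ((hq.eventually hV).and
      (hu'.eventually (Metric.ball_mem_nhds _ hδ))).exists
    have hnS := huS (φ n)
    have hle := le_csSup hbdd hnS
    obtain ⟨Y, hY⟩ := h _ hnS.1 (by simpa [Real.dist_eq] using hn2) X (hlift _ hnS) hn1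
      (sSup S + δ / 2) (by linarith) (by linarith)
    have : sSup S + δ / 2 ∈ S := ⟨by linarith [hnS.1], Y, hY⟩
    linarith [le_csSup hbdd this]

end RayLift

lemma exists_pos_mem_eq_of_between {E : Type*} [TopologicalSpace E] {X : ℝ → E} {I : Set ℝ}
    (hI : I.OrdConnected) (h0 : 0 ∈ I) (hpos : ∀ t ∈ I, 0 ≤ t) (hX : ContinuousOn X I)
    {h : E → ℝ} (hh : Continuous h) {c t₁ : ℝ}
    (ht₁ : t₁ ∈ I) (hc : h (X 0) < c ∧ c < h (X t₁) ∨ h (X t₁) < c ∧ c < h (X 0)) :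
    ∃ t ∈ I, 0 < t ∧ h (X t) = c := by
  have hpre : ((fun t => h (X t)) '' I).OrdConnected :=
    (hI.isPreconnected.image _ (hh.comp_continuousOn hX)).ordConnected
  have hm0 : h (X 0) ∈ (fun t => h (X t)) '' I := ⟨0, h0, rfl⟩
  have hm1 : h (X t₁) ∈ (fun t => h (X t)) '' I := ⟨t₁, ht₁, rfl⟩
  have hne : c ≠ h (X 0) := by rcases hc with h | h; exacts [h.1.ne', h.2.ne]
  have : c ∈ (fun t => h (X t)) '' I := by
    rcases hc with h | h
    · exact hpre.out hm0 hm1 ⟨h.1.le, h.2.le⟩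
    · exact hpre.out hm1 hm0 ⟨h.1.le, h.2.le⟩
  obtain ⟨t, ht, rfl⟩ := this
  exact ⟨t, ht, lt_of_le_of_ne (hpos t ht) (by rintro rfl; exact hne rfl), rfl⟩

section Rolle

variable {σ : Type*} [Fintype σ] [DecidableEq σ]

/-- A family of disjoint arcs along which every component of `Φ` but the one of index `r₀`
vanishes, parametrized by the value of this component up to a constant. -/
structure IsArcFamily (Φ : (σ → ℝ) → σ → ℝ) (r₀ : σ) {ι : Type*} (X : ι → ℝ → σ → ℝ)
    (I : ι → Set ℝ) (s : ι → ℝ) : Prop where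
  ne_zero : ∀ e, s e ≠ 0
  reg : ∀ e, ∀ t ∈ I e, Function.Injective (fderiv ℝ Φ (X e t))
  map : ∀ e, ∀ t ∈ I e, Φ (X e t) = t • Pi.single r₀ (s e)
  deriv : ∀ e, ∀ t ∈ I e, 0 < t →
    ∃ w, HasDerivAt (X e) w t ∧ fderiv ℝ Φ (X e t) w = Pi.single r₀ (s e)
  inj : ∀ e₁ e₂, ∀ t₁ ∈ I e₁, ∀ t₂ ∈ I e₂, 0 < t₁ → 0 < t₂ → X e₁ t₁ = X e₂ t₂ → e₁ = e₂

/-- On an arc, a point where a function `h` has nonzero derivative along the arc is a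
nondegenerate zero of the system in which the component `r₀` is replaced by `h - c`. -/
lemma IsArcFamily.isNondegZero {Φ : (σ → ℝ) → σ → ℝ} (hΦ : ContDiff ℝ 1 Φ) {r₀ : σ} {ι : Type*}
    {X : ι → ℝ → σ → ℝ} {I : ι → Set ℝ} {s : ι → ℝ} (hX : IsArcFamily Φ r₀ X I s)
    {h : (σ → ℝ) → ℝ} (hh : ContDiff ℝ 1 h) {e : ι} {t : ℝ} (ht : t ∈ I e) (ht0 : 0 < t)
    (hreg : ¬ HasDerivAt (fun τ => h (X e τ)) 0 t) {c : ℝ} (hc : h (X e t) = c) :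
    IsNondegZero (fun x => Function.update (Φ x) r₀ (h x - c)) (X e t) := by
  set q := X e t with hq
  obtain ⟨w, hw, hwv⟩ := hX.deriv e t ht ht0
  have hdh : HasFDerivAt h (fderiv ℝ h q) q := (hh.differentiable (by simp) q).hasFDerivAt
  have hdΦ : HasFDerivAt Φ (fderiv ℝ Φ q) q := (hΦ.differentiable (by simp) q).hasFDerivAt
  have hne : fderiv ℝ h q w ≠ 0 := fun h0 => hreg (h0 ▸ hdh.comp_hasDerivAt t hw)
  have hderiv : HasFDerivAt (fun x => Function.update (Φ x) r₀ (h x - c))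
      (ContinuousLinearMap.pi fun r => if r = r₀ then fderiv ℝ h q else
        (ContinuousLinearMap.proj r).comp (fderiv ℝ Φ q)) q := by
    refine hasFDerivAt_pi.2 fun r => ?_
    by_cases hr : r = r₀
    · subst hr
      simpa using hdh.sub_const c
    · simpa [hr] using hasFDerivAt_pi'.1 hdΦ r
  refine ⟨?_, ?_⟩
  · ext r
    by_cases hr : r = r₀
    · subst hr; simp [hc]
    · simp [hr, hX.map e t ht, hq]
  · rw [hderiv.fderiv, injective_iff_map_eq_zero]
    intro ξ hξ
    have h1 : ∀ r, r ≠ r₀ → fderiv ℝ Φ q ξ r = 0 := fun r hr => by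
      simpa [hr] using congrFun hξ r
    have h2 : fderiv ℝ h q ξ = 0 := by simpa using congrFun hξ r₀
    have h3 : ξ = (fderiv ℝ Φ q ξ r₀ / s e) • w := by
      refine hX.reg e t ht ?_
      rw [map_smul, hwv]
      ext r
      by_cases hr : r = r₀
      · subst hr; simp [hX.ne_zero e, ← hq]
      · simp [hr, h1 r hr, ← hq]
    have h4 : fderiv ℝ Φ q ξ r₀ / s e = 0 := by
      rw [h3, map_smul, smul_eq_mul] at h2
      exact (mul_eq_zero.1 h2).resolve_right hne
    rw [h3, h4, zero_smul]

/-- If a function takes all values of an interval on each arc of a family, the number of arcs is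
bounded by the number of nondegenerate zeros (by Sard's theorem in dimension one). -/
lemma IsArcFamily.card_le {Φ : (σ → ℝ) → σ → ℝ} (hΦ : ContDiff ℝ 1 Φ) {r₀ : σ} {ι : Type*}
    {X : ι → ℝ → σ → ℝ} {I : ι → Set ℝ} {s : ι → ℝ} (hX : IsArcFamily Φ r₀ X I s)
    {h : (σ → ℝ) → ℝ} (hh : ContDiff ℝ 1 h) {a b : ℝ} (hab : a < b) {A : Finset ι}
    (hA : ∀ e ∈ A, ∀ c ∈ Ioo a b, ∃ t ∈ I e, 0 < t ∧ h (X e t) = c) {B : ℕ}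
    (hB : ∀ c : ℝ, NondegZerosLE (fun x => Function.update (Φ x) r₀ (h x - c)) B) :
    A.card ≤ B := by
  classical
  let N : ι → Set ℝ := fun e => (fun τ => h (X e τ)) '' {t | HasDerivAt (fun τ => h (X e τ)) 0 t}
  have hN : ∀ e, MeasureTheory.volume (N e) = 0 := fun e => by
    refine MeasureTheory.addHaar_image_eq_zero_of_det_fderivWithin_eq_zero _ (f' := fun _ => 0)
      (fun t ht => ?_) fun t _ => ?_
    · simpa using (HasDerivAt.hasFDerivAt ht).hasFDerivWithinAt
    · simp [ContinuousLinearMap.det]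
  have hN' : MeasureTheory.volume (⋃ e ∈ A, N e) = 0 :=
    (MeasureTheory.measure_biUnion_null_iff A.countable_toSet).2 fun e _ => hN e
  obtain ⟨c, hc, hcN⟩ : ∃ c ∈ Ioo a b, c ∉ ⋃ e ∈ A, N e := by
    by_contra! hcon
    have := MeasureTheory.measure_mono_null hcon hN'
    rw [Real.volume_Ioo, ENNReal.ofReal_eq_zero] at this
    linarith
  choose! t htI ht0 htc using fun e he => hA e he c hc
  have hinj : InjOn (fun e => X e (t e)) A := fun e he e' he' hee =>
    hX.inj e e' _ (htI e he) _ (htI e' he') (ht0 e he) (ht0 e' he') hee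
  rw [← Finset.card_image_of_injOn hinj]
  refine hB c _ fun q hq => ?_
  obtain ⟨e, he, rfl⟩ := Finset.mem_image.1 hq
  refine hX.isNondegZero hΦ hh (htI e he) (ht0 e he) (fun hd => hcN ?_) (htc e he)
  exact mem_biUnion he ⟨t e, hd, htc e he⟩

/-- There is a linear form that is unbounded on each of finitely many unbounded sets. -/
lemma exists_linearForm_unbounded {ι : Type*} [Finite ι] (S : ι → Set (σ → ℝ))
    (hS : ∀ e, ¬ Bornology.IsBounded (S e)) :
    ∃ w : σ → ℝ, ∀ e, ∀ M : ℝ, ∃ x ∈ S e, M < |∑ j, w j * x j| := by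
  let W : ι → Subspace ℝ (σ → ℝ) := fun e =>
    { carrier := {w | ∃ M : ℝ, ∀ x ∈ S e, |∑ j, w j * x j| ≤ M}
      zero_mem' := ⟨0, fun x _ => by simp⟩
      add_mem' := by
        rintro w w' ⟨M, hM⟩ ⟨M', hM'⟩
        refine ⟨M + M', fun x hx => ?_⟩
        simp only [Pi.add_apply, add_mul, Finset.sum_add_distrib]
        exact (abs_add_le _ _).trans (add_le_add (hM x hx) (hM' x hx))
      smul_mem' := by
        rintro a w ⟨M, hM⟩
        refine ⟨|a| * M, fun x hx => ?_⟩
        simp only [Pi.smul_apply, smul_eq_mul, mul_assoc, ← Finset.mul_sum, abs_mul]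
        exact mul_le_mul_of_nonneg_left (hM x hx) (abs_nonneg a) }
  by_contra! hcon
  obtain ⟨e, he⟩ := Subspace.exists_eq_top_of_iUnion_eq_univ (p := W) <| by
    refine eq_univ_of_forall fun w => ?_
    obtain ⟨e, M, hM⟩ := hcon w
    exact mem_iUnion.2 ⟨e, M, hM⟩
  have hcoord : ∀ r : σ, ∃ M : ℝ, ∀ x ∈ S e, |x r| ≤ M := fun r => by
    have : Pi.single r (1 : ℝ) ∈ W e := he ▸ Submodule.mem_top
    obtain ⟨M, hM⟩ := this
    exact ⟨M, fun x hx => by simpa [Pi.single_apply] using hM x hx⟩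
  choose M hM using hcoord
  refine hS e (isBounded_iff_forall_norm_le.2 ⟨∑ r, |M r|, fun x hx => ?_⟩)
  rw [pi_norm_le_iff_of_nonneg (Finset.sum_nonneg fun r _ => abs_nonneg _)]
  intro r
  exact ((hM r x hx).trans (le_abs_self _)).trans
    (Finset.single_le_sum (f := fun r => |M r|) (fun _ _ => abs_nonneg _) (Finset.mem_univ r))

/-- **Khovanskii's Rolle theorem**: `J` is a function with the same zeros as the Jacobian
determinant of the system `Φ`, and the component of index `r₀` of the system is replaced either
by a translate of `J` or by an affine function. -/
theorem nondegZerosLE_add {Φ : (σ → ℝ) → σ → ℝ} (hΦ : ContDiff ℝ 1 Φ) {J : (σ → ℝ) → ℝ}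
    (hJ : ContDiff ℝ 1 J) (hJΦ : ∀ x, J x ≠ 0 ↔ Function.Injective (fderiv ℝ Φ x)) (r₀ : σ)
    {Z H : ℕ} (hZ : ∀ c : ℝ, NondegZerosLE (fun x => Function.update (Φ x) r₀ (J x - c)) Z)
    (hH : ∀ (w : σ → ℝ) (c : ℝ),
      NondegZerosLE (fun x => Function.update (Φ x) r₀ (∑ j, w j * x j - c)) H) :
    NondegZerosLE Φ (Z + H) := by
  classical
  intro T hT
  rcases T.eq_empty_or_nonempty with rfl | hTne
  · simp
  let U : Set (σ → ℝ) := {x | J x ≠ 0}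
  have hUo : IsOpen U := isOpen_ne_fun hJ.continuous continuous_const
  have hU : ∀ x ∈ U, Function.Injective (fderiv ℝ Φ x) := fun x hx => (hJΦ x).1 hx
  let s : T × Bool → ℝ := fun e => if e.2 then 1 else -1
  have hs : ∀ e, s e ≠ 0 := fun e => by
    simp only [s]; split_ifs <;> norm_num
  have hex := fun e : T × Bool => exists_maximal_rayLift (p := e.1.1) (v := Pi.single r₀ (s e))
    hΦ hUo hU ((hJΦ _).2 (hT _ e.1.2).2) (hT _ e.1.2).1 (by simpa using hs e)
  choose X I hI h0 hpos hlift hderiv hleave using hex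
  have hfam : IsArcFamily Φ r₀ X I s := by
    refine ⟨hs, fun e t ht => hU _ ((hlift e).mem t ht), fun e t ht => (hlift e).map t ht,
      hderiv, fun e e' t ht t' ht' hp hp' hXX => ?_⟩
    have h1 : t * s e = t' * s e' := by
      have := (hlift e).map t ht
      rw [hXX, (hlift e').map t' ht'] at this
      simpa using (congrFun this r₀).symm
    obtain ⟨⟨p, hpT⟩, b⟩ := e
    obtain ⟨⟨p', hpT'⟩, b'⟩ := e'
    have hbt : b = b' ∧ t = t' := by
      cases b <;> cases b' <;> simp [s] at h1 ⊢ <;> linarith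
    obtain ⟨rfl, rfl⟩ := hbt
    have hsub : ∀ e, t ∈ I e → Icc 0 t ⊆ I e := fun e he => (hI e).out (h0 e) he
    have h2 := ((hlift (⟨p, hpT⟩, b)).mono (hsub _ ht)).eqOn hΦ hU ordConnected_Icc
      ((hlift (⟨p', hpT'⟩, b)).mono (hsub _ ht')) (right_mem_Icc.2 hp.le) hXX
      (left_mem_Icc.2 hp.le)
    rw [(hlift (⟨p, hpT⟩, b)).zero, (hlift (⟨p', hpT'⟩, b)).zero] at h2
    simp only at h2
    subst h2
    rfl
  let small : T × Bool → Prop := fun e => ∀ ε > 0, ∃ t ∈ I e, |J (X e t)| < ε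
  obtain ⟨p₀, hp₀, hmin⟩ := T.exists_min_image (fun p => |J p|) hTne
  have hε : 0 < |J p₀| := abs_pos.2 ((hJΦ _).2 (hT _ hp₀).2)
  have hX0 : ∀ e, X e 0 = e.1.1 := fun e => (hlift e).zero
  have hcardp : (Finset.univ.filter fun e : T × Bool => small e ∧ 0 < J e.1).card ≤ Z := by
    refine hfam.card_le hΦ hJ hε (fun e he c hc => ?_) hZ
    obtain ⟨hsm, hJp⟩ := (Finset.mem_filter.1 he).2
    obtain ⟨t, ht, htc⟩ := hsm c hc.1
    refine exists_pos_mem_eq_of_between (hI e) (h0 e) (hpos e) (hlift e).cont hJ.continuous ht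
      (Or.inr ⟨(abs_lt.1 htc).2, ?_⟩)
    rw [hX0, ← abs_of_pos hJp]
    exact hc.2.trans_le (hmin _ e.1.2)
  have hcardn : (Finset.univ.filter fun e : T × Bool => small e ∧ J e.1 < 0).card ≤ Z := by
    refine hfam.card_le hΦ hJ (neg_lt_zero.2 hε) (fun e he c hc => ?_) hZ
    obtain ⟨hsm, hJp⟩ := (Finset.mem_filter.1 he).2
    obtain ⟨t, ht, htc⟩ := hsm (-c) (neg_pos.2 hc.2)
    refine exists_pos_mem_eq_of_between (hI e) (h0 e) (hpos e) (hlift e).cont hJ.continuous ht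
      (Or.inl ⟨?_, by linarith [(abs_lt.1 htc).1]⟩)
    have := hmin _ e.1.2
    rw [abs_of_neg hJp] at this
    rw [hX0]
    linarith [hc.1]
  obtain ⟨w, hw⟩ := exists_linearForm_unbounded
    (fun e : {e : T × Bool // ¬ small e} => X e '' I e) <| by
    rintro ⟨e, he⟩ hb
    simp only [small, not_forall, not_exists, not_and, not_lt] at he
    obtain ⟨ε, hε, hJε⟩ := he
    obtain ⟨t, ht, hK⟩ := hleave e (closure (X e '' I e) ∩ {x | ε ≤ |J x|})
      (fun x hx => abs_pos.1 (hε.trans_le hx.2))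
      (hb.isCompact_closure.inter_right (isClosed_le continuous_const hJ.continuous.abs))
    exact hK ⟨subset_closure ⟨t, ht, rfl⟩, hJε t ht⟩
  let ℓ : (σ → ℝ) → ℝ := fun x => ∑ j, w j * x j
  have hℓ : ContDiff ℝ 1 ℓ := by fun_prop
  set R := ∑ p ∈ T, |ℓ p| with hR
  have hRle : ∀ e : T × Bool, |ℓ (X e 0)| ≤ R := fun e => by
    rw [hX0]
    exact Finset.single_le_sum (f := fun p => |ℓ p|) (fun _ _ => abs_nonneg _) e.1.2
  have hcardu : (Finset.univ.filter fun e : T × Bool =>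
      ∃ t ∈ I e, R + 1 < ℓ (X e t)).card ≤ H := by
    refine hfam.card_le hΦ hℓ (lt_add_one R) (fun e he c hc => ?_) (hH w)
    obtain ⟨t, ht, htR⟩ := (Finset.mem_filter.1 he).2
    exact exists_pos_mem_eq_of_between (hI e) (h0 e) (hpos e) (hlift e).cont hℓ.continuous ht
      (Or.inl ⟨((le_abs_self _).trans (hRle e)).trans_lt hc.1, hc.2.trans htR⟩)
  have hcardl : (Finset.univ.filter fun e : T × Bool =>
      ∃ t ∈ I e, ℓ (X e t) < -(R + 1)).card ≤ H := by
    refine hfam.card_le hΦ hℓ (neg_lt_neg (lt_add_one R)) (fun e he c hc => ?_) (hH w)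
    obtain ⟨t, ht, htR⟩ := (Finset.mem_filter.1 he).2
    exact exists_pos_mem_eq_of_between (hI e) (h0 e) (hpos e) (hlift e).cont hℓ.continuous ht
      (Or.inr ⟨htR.trans hc.1, hc.2.trans_le (neg_le_of_abs_le (hRle e))⟩)
  have hcover : (Finset.univ : Finset (T × Bool)) ⊆
      ((Finset.univ.filter fun e : T × Bool => small e ∧ 0 < J e.1) ∪
      (Finset.univ.filter fun e : T × Bool => small e ∧ J e.1 < 0)) ∪
      ((Finset.univ.filter fun e : T × Bool => ∃ t ∈ I e, R + 1 < ℓ (X e t)) ∪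
      (Finset.univ.filter fun e : T × Bool => ∃ t ∈ I e, ℓ (X e t) < -(R + 1))) := by
    intro e _
    simp only [Finset.mem_union, Finset.mem_filter, Finset.mem_univ, true_and]
    by_cases hsm : small e
    · have hne : J e.1 ≠ 0 := (hJΦ _).2 (hT _ e.1.2).2
      rcases lt_or_gt_of_ne hne with h | h
      · exact Or.inl (Or.inr ⟨hsm, h⟩)
      · exact Or.inl (Or.inl ⟨hsm, h⟩)
    · obtain ⟨_, ⟨t, ht, rfl⟩, htR⟩ := hw ⟨e, hsm⟩ (R + 1)
      rcases lt_abs.1 htR with h | h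
      · exact Or.inr (Or.inl ⟨t, ht, h⟩)
      · exact Or.inr (Or.inr ⟨t, ht, by simp only [ℓ]; linarith⟩)
  have h2 := Finset.card_le_card hcover
  have h3 := h2.trans ((Finset.card_union_le _ _).trans
    (add_le_add (Finset.card_union_le _ _) (Finset.card_union_le _ _)))
  have h4 : (Finset.univ : Finset (T × Bool)).card = T.card * 2 := by
    simp [Fintype.card_prod]
  omega

end Rolle

lemma NondegZerosLE.mono {E F : Type*} [NormedAddCommGroup E] [NormedSpace ℝ E]
    [NormedAddCommGroup F] [NormedSpace ℝ F] {Φ : E → F} {B B' : ℕ} (h : NondegZerosLE Φ B)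
    (hB : B ≤ B') : NondegZerosLE Φ B' :=
  fun T hT => (h T hT).trans hB

/-- If the rows of the Jacobian matrix of `Φ` are nonzero multiples of the rows of `A`, the
derivative of `Φ` is injective if and only if `A` is nonsingular. -/
lemma injective_fderiv_iff_det_ne_zero {σ : Type*} [Fintype σ] [DecidableEq σ]
    {Φ : (σ → ℝ) → σ → ℝ} {x : σ → ℝ} {ρ : σ → ℝ} (hρ : ∀ r, ρ r ≠ 0) {A : Matrix σ σ ℝ}
    (h : ∀ r, HasFDerivAt (fun y => Φ y r)
      (ρ r • ∑ c, A r c • (ContinuousLinearMap.proj c : (σ → ℝ) →L[ℝ] ℝ)) x) :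
    Function.Injective (fderiv ℝ Φ x) ↔ A.det ≠ 0 := by
  have hd : HasFDerivAt Φ (ContinuousLinearMap.pi fun r =>
      ρ r • ∑ c, A r c • (ContinuousLinearMap.proj c : (σ → ℝ) →L[ℝ] ℝ)) x := hasFDerivAt_pi.2 h
  have hzero : ∀ ξ, fderiv ℝ Φ x ξ = 0 ↔ A.mulVec ξ = 0 := fun ξ => by
    rw [hd.fderiv, funext_iff, funext_iff]
    refine forall_congr' fun r => ?_
    simp [hρ r, Matrix.mulVec, dotProduct]
  rw [injective_iff_map_eq_zero, ne_eq, ← Matrix.exists_mulVec_eq_zero_iff]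
  simp only [hzero]
  grind

lemma totalDegree_det_le {σ τ : Type*} [Fintype σ] [DecidableEq σ]
    (M : Matrix σ σ (MvPolynomial τ ℝ)) (ρ γ : σ → ℕ)
    (h : ∀ r c, (M r c).totalDegree ≤ ρ r + γ c) :
    M.det.totalDegree ≤ ∑ r, ρ r + ∑ c, γ c := by
  rw [Matrix.det_apply]
  refine totalDegree_finsetSum_le fun π _ => (totalDegree_smul_le _ _).trans ?_
  refine (totalDegree_finsetProd _ _).trans ((Finset.sum_le_sum fun c _ => h (π c) c).trans ?_)
  rw [Finset.sum_add_distrib, Equiv.sum_comp π ρ]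

section Mixed

variable {ι κ : Type*} [Fintype ι] [DecidableEq κ]

/-- The system in the variables `x_i`, `u_j` whose equations of index `j ∈ S` are
`u_j * exp (- ∑ i, a j i * x_i) = 1` and whose other equations are the polynomials `P`. -/
noncomputable def mixedSystem (a : κ → ι → ℝ) (P : ι ⊕ κ → MvPolynomial (ι ⊕ κ) ℝ)
    (S : Finset κ) (x : ι ⊕ κ → ℝ) (r : ι ⊕ κ) : ℝ :=
  Sum.elim (fun i => eval x (P (.inl i)))
    (fun j => if j ∈ S then x (.inr j) * Real.exp (-∑ i, a j i * x (.inl i)) - 1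
      else eval x (P (.inr j))) r

/-- The Jacobian matrix of `mixedSystem`, up to positive factors in its rows. -/
noncomputable def mixedJacobian (a : κ → ι → ℝ) (P : ι ⊕ κ → MvPolynomial (ι ⊕ κ) ℝ)
    (S : Finset κ) : Matrix (ι ⊕ κ) (ι ⊕ κ) (MvPolynomial (ι ⊕ κ) ℝ) :=
  Matrix.of fun r c => Sum.elim (fun i => pderiv c (P (.inl i)))
    (fun j => if j ∈ S then
        Sum.elim (fun i => -(C (a j i) * X (.inr j))) (fun j' => if j' = j then 1 else 0) c
      else pderiv c (P (.inr j))) r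

lemma update_mixedSystem [DecidableEq ι] (a : κ → ι → ℝ)
    (P : ι ⊕ κ → MvPolynomial (ι ⊕ κ) ℝ) {S : Finset κ} {j : κ} (hj : j ∉ S)
    (Q : MvPolynomial (ι ⊕ κ) ℝ) (x : ι ⊕ κ → ℝ) :
    Function.update (mixedSystem a P (insert j S) x) (.inr j) (eval x Q) =
      mixedSystem a (Function.update P (.inr j) Q) S x := by
  ext r
  rcases r with i | j'
  · simp [mixedSystem]
  · by_cases hjj : j' = j
    · subst hjj
      simp [mixedSystem, hj]
    · simp [mixedSystem, hjj]

variable [Fintype κ]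

lemma hasFDerivAt_mul_exp (a : ι → ℝ) (j : κ) (x : ι ⊕ κ → ℝ) :
    HasFDerivAt (fun y : ι ⊕ κ → ℝ => y (.inr j) * Real.exp (-∑ i, a i * y (.inl i)) - 1)
      (Real.exp (-∑ i, a i * x (.inl i)) • ∑ c, (Sum.elim (fun i => -(a i * x (.inr j)))
        (fun j' => if j' = j then 1 else 0) c) •
        (ContinuousLinearMap.proj c : (ι ⊕ κ → ℝ) →L[ℝ] ℝ)) x := by
  have h1 : HasFDerivAt (fun y : ι ⊕ κ → ℝ => -∑ i, a i * y (.inl i))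
      (-∑ i, a i • (ContinuousLinearMap.proj (.inl i) : (ι ⊕ κ → ℝ) →L[ℝ] ℝ)) x :=
    (HasFDerivAt.fun_sum fun i _ =>
      (hasFDerivAt_apply (𝕜 := ℝ) (Sum.inl i : ι ⊕ κ) x).const_mul (a i)).neg
  have h2 := ((hasFDerivAt_apply (𝕜 := ℝ) (Sum.inr j : ι ⊕ κ) x).fun_mul h1.exp).sub_const 1
  refine h2.congr_fderiv ?_
  ext v
  simp [Fintype.sum_sum_type, Finset.mul_sum]
  ring_nf

lemma contDiff_mixedSystem (a : κ → ι → ℝ) (P : ι ⊕ κ → MvPolynomial (ι ⊕ κ) ℝ)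
    (S : Finset κ) : ContDiff ℝ 1 (mixedSystem a P S) := by
  refine contDiff_pi.2 ?_
  rintro (i | j)
  · exact contDiff_eval (P (.inl i))
  · by_cases hj : j ∈ S
    · simp only [mixedSystem, Sum.elim_inr, hj, if_true]
      fun_prop
    · simpa [mixedSystem, hj] using contDiff_eval (P (.inr j))

variable [DecidableEq ι]

lemma injective_fderiv_mixedSystem_iff (a : κ → ι → ℝ) (P : ι ⊕ κ → MvPolynomial (ι ⊕ κ) ℝ)
    (S : Finset κ) (x : ι ⊕ κ → ℝ) :
    Function.Injective (fderiv ℝ (mixedSystem a P S) x) ↔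
      ((mixedJacobian a P S).map (eval x)).det ≠ 0 := by
  refine injective_fderiv_iff_det_ne_zero (ρ := Sum.elim (fun _ => 1)
    fun j => if j ∈ S then Real.exp (-∑ i, a j i * x (.inl i)) else 1) ?_ ?_
  · rintro (i | j)
    · simp
    · simp only [Sum.elim_inr]
      split_ifs
      exacts [(Real.exp_pos _).ne', one_ne_zero]
  · rintro (i | j)
    · simpa [mixedSystem, mixedJacobian] using hasFDerivAt_eval (P (.inl i)) x
    · by_cases hj : j ∈ S
      · simp only [mixedSystem, mixedJacobian, Sum.elim_inr, hj, if_true, Matrix.map_apply,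
          Matrix.of_apply]
        refine (hasFDerivAt_mul_exp (a j) j x).congr_fderiv ?_
        congr 1
        refine Finset.sum_congr rfl fun c _ => ?_
        rcases c with i | j'
        · simp
        · by_cases hjj : j' = j <;> simp [hjj]
      · simpa [mixedSystem, mixedJacobian, hj] using hasFDerivAt_eval (P (.inr j)) x

lemma totalDegree_det_mixedJacobian_le (a : κ → ι → ℝ) {P : ι ⊕ κ → MvPolynomial (ι ⊕ κ) ℝ}
    (S : Finset κ) {m : ι ⊕ κ → ℕ} (hm : ∀ r, (P r).totalDegree ≤ m r) (hm1 : ∀ r, 1 ≤ m r) :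
    (mixedJacobian a P S).det.totalDegree ≤ ∑ r ∈ (S.map Function.Embedding.inr)ᶜ, m r := by
  refine (totalDegree_det_le _
    (fun r => if r ∈ (S.map Function.Embedding.inr)ᶜ then m r - 1 else 0)
    (Sum.elim (fun _ => 1) fun _ => 0) ?_).trans ?_
  · rintro (i | j) c
    · have := (totalDegree_pderiv_le c (P (.inl i))).trans (Nat.sub_le_sub_right (hm _) 1)
      simpa [mixedJacobian] using this.trans (Nat.le_add_right _ _)
    · by_cases hj : j ∈ S
      · rcases c with i | j'
        · simp only [mixedJacobian, Matrix.of_apply, Sum.elim_inr, hj, if_true, Sum.elim_inl,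
            totalDegree_neg]
          refine (totalDegree_mul _ _).trans ?_
          simp
        · by_cases hjj : j' = j <;> simp [mixedJacobian, hj, hjj]
      · have := (totalDegree_pderiv_le c (P (.inr j))).trans (Nat.sub_le_sub_right (hm _) 1)
        simpa [mixedJacobian, hj] using this.trans (Nat.le_add_right _ _)
  · rw [Finset.sum_ite_mem, Finset.univ_inter]
    have h1 : ∑ c : ι ⊕ κ, Sum.elim (fun _ => 1) (fun _ => 0) c ≤
        ∑ r ∈ (S.map (Function.Embedding.inr : κ ↪ ι ⊕ κ))ᶜ, 1 := by
      have : ∑ c : ι ⊕ κ, Sum.elim (fun _ => 1) (fun _ => 0) c =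
          ∑ r ∈ Finset.univ.map (Function.Embedding.inl : ι ↪ ι ⊕ κ), 1 := by simp
      rw [this]
      refine Finset.sum_le_sum_of_subset fun r hr => ?_
      obtain ⟨i, -, rfl⟩ := Finset.mem_map.1 hr
      simp
    refine (Nat.add_le_add_left h1 _).trans ?_
    rw [← Finset.sum_add_distrib]
    exact Finset.sum_le_sum fun r _ => by rw [Nat.sub_add_cancel (hm1 r)]

/-- **Khovanskii's theorem**: a bound for the number of nondegenerate zeros of a system of
polynomial equations in variables `x` and exponentials of linear forms in `x`. -/
theorem nondegZerosLE_mixedSystem [Nonempty ι] (a : κ → ι → ℝ) (S : Finset κ) :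
    ∀ (P : ι ⊕ κ → MvPolynomial (ι ⊕ κ) ℝ) (m : ι ⊕ κ → ℕ),
      (∀ r, (P r).totalDegree ≤ m r) → (∀ r, 1 ≤ m r) →
      NondegZerosLE (mixedSystem a P S)
        ((∏ r ∈ (S.map Function.Embedding.inr)ᶜ, m r) *
          (1 + ∑ r ∈ (S.map Function.Embedding.inr)ᶜ, m r) ^ S.card *
          2 ^ (S.card * (S.card - 1) / 2)) := by
  induction S using Finset.induction_on with
  | empty =>
    intro P m hm hm1
    have h : mixedSystem a P ∅ = fun x r => eval x (P r) := by
      ext x r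
      rcases r with i | j <;> simp [mixedSystem]
    rw [h]
    simpa using nondegZerosLE_eval P hm hm1
  | insert j S hj ih =>
    intro P m hm hm1
    set N : Finset (ι ⊕ κ) := ((insert j S).map Function.Embedding.inr)ᶜ with hN
    have hNS : (S.map Function.Embedding.inr)ᶜ = insert (Sum.inr j : ι ⊕ κ) N := by
      ext r
      rcases r with i | j'
      · simp [hN]
      · by_cases hjj : j' = j
        · subst hjj; simp [hj]
        · simp [hN, hjj]
    have hjN : (Sum.inr j : ι ⊕ κ) ∉ N := by simp [hN]
    set M := ∑ r ∈ N, m r with hM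
    have hM1 : 1 ≤ M := by
      obtain ⟨i⟩ := ‹Nonempty ι›
      have hi : (Sum.inl i : ι ⊕ κ) ∈ N := by simp [hN]
      exact (hm1 (.inl i)).trans (Finset.single_le_sum (fun r _ => Nat.zero_le (m r)) hi)
    have step : ∀ (Q : MvPolynomial (ι ⊕ κ) ℝ) (d : ℕ), Q.totalDegree ≤ d → 1 ≤ d →
        NondegZerosLE
          (fun x => Function.update (mixedSystem a P (insert j S) x) (.inr j) (eval x Q))
          ((d * ∏ r ∈ N, m r) * (1 + (d + M)) ^ S.card * 2 ^ (S.card * (S.card - 1) / 2)) := by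
      intro Q d hQ hd
      simp only [update_mixedSystem a P hj Q]
      have := ih (Function.update P (.inr j) Q) (Function.update m (.inr j) d) ?_ ?_
      · rw [hNS, Finset.prod_insert hjN, Finset.sum_insert hjN, Function.update_self] at this
        have hne : ∀ r ∈ N, Function.update m (.inr j) d r = m r := fun r hr =>
          Function.update_of_ne (ne_of_mem_of_not_mem hr hjN) _ _
        rwa [Finset.prod_congr rfl hne, Finset.sum_congr rfl hne] at this
      · intro r
        by_cases hr : r = .inr j
        · subst hr; simpa using hQ
        · simpa [hr] using hm r
      · intro r
        by_cases hr : r = .inr j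
        · subst hr; simpa using hd
        · simpa [hr] using hm1 r
    have hdet : ∀ x, eval x (mixedJacobian a P (insert j S)).det =
        ((mixedJacobian a P (insert j S)).map (eval x)).det := fun x => RingHom.map_det _ _
    have key := nondegZerosLE_add (contDiff_mixedSystem a P (insert j S))
      (J := fun x => eval x (mixedJacobian a P (insert j S)).det) (contDiff_eval _)
      (fun x => by rw [hdet, injective_fderiv_mixedSystem_iff]) (.inr j)
      (fun c => by
        have := step ((mixedJacobian a P (insert j S)).det - C c) M
          ((totalDegree_sub_C_le _ _).trans (totalDegree_det_mixedJacobian_le a _ hm hm1)) hM1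
        simpa using this)
      (fun w c => by
        have := step (∑ r, C (w r) * X r - C c) 1
          ((totalDegree_sub_C_le _ _).trans (totalDegree_finsetSum_le fun r _ =>
            (totalDegree_mul _ _).trans (by simp))) le_rfl
        simpa using this)
    refine key.mono ?_
    rw [Finset.card_insert_of_notMem hj, Nat.triangle_succ]
    set p := ∏ r ∈ N, m r
    set s := S.card
    set q := 2 ^ (s * (s - 1) / 2)
    calc M * p * (1 + (M + M)) ^ s * q + p * (1 + (1 + M)) ^ s * q
        ≤ M * p * (2 * (1 + M)) ^ s * q + p * (2 * (1 + M)) ^ s * q := by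
          gcongr <;> omega
      _ = p * (1 + M) ^ (s + 1) * (q * 2 ^ s) := by rw [mul_pow]; ring
      _ = _ := by rw [← pow_add]

end Mixed

section Fewnomial

variable {ι : Type*}

/-- The polynomials `f`, written as linear forms in the monomials with exponents in `D`. -/
noncomputable def monomialForms (f : ι → MvPolynomial ι ℝ) (D : Finset (ι →₀ ℕ)) :
    ι ⊕ D → MvPolynomial (ι ⊕ D) ℝ :=
  Sum.elim (fun i => ∑ d : D, C (coeff d (f i)) * X (.inr d)) 0

lemma totalDegree_monomialForms_le (f : ι → MvPolynomial ι ℝ) (D : Finset (ι →₀ ℕ))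
    (r : ι ⊕ D) : (monomialForms f D r).totalDegree ≤ 1 := by
  rcases r with i | d
  · exact totalDegree_finsetSum_le fun d _ => (totalDegree_mul _ _).trans (by simp)
  · simp [monomialForms]

variable [Fintype ι]

lemma eval_eq_sum_of_support_subset {D : Finset (ι →₀ ℕ)} {p : MvPolynomial ι ℝ}
    (hp : p.support ⊆ D) (z : ι → ℝ) :
    eval z p = ∑ d : D, coeff d p * ∏ i, z i ^ (d : ι →₀ ℕ) i := by
  rw [eval_eq', Finset.sum_coe_sort D fun d => coeff d p * ∏ i, z i ^ d i]
  refine Finset.sum_subset hp fun d _ hd => ?_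
  rw [notMem_support_iff.1 hd, zero_mul]

lemma mul_eval_pderiv_eq_sum {D : Finset (ι →₀ ℕ)} {p : MvPolynomial ι ℝ}
    (hp : p.support ⊆ D) (z : ι → ℝ) (l : ι) :
    z l * eval z (pderiv l p) =
      ∑ d : D, coeff d p * ((d : ι →₀ ℕ) l * ∏ i, z i ^ (d : ι →₀ ℕ) i) := by
  rw [Finset.sum_coe_sort D fun d => coeff d p * (d l * ∏ i, z i ^ d i)]
  have h : X l * pderiv l p = ∑ d ∈ D, d l • monomial d (coeff d p) := by
    conv_lhs => rw [p.as_sum, map_sum, Finset.mul_sum]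
    simp only [X_mul_pderiv_monomial]
    refine Finset.sum_subset hp fun d _ hd => ?_
    rw [notMem_support_iff.1 hd, monomial_zero, smul_zero]
  have h' := congrArg (eval z) h
  rw [map_mul, eval_X, map_sum] at h'
  rw [h']
  refine Finset.sum_congr rfl fun d _ => ?_
  rw [map_nsmul, eval_monomial, Finsupp.prod_fintype _ _ fun i => pow_zero (z i), nsmul_eq_mul]
  ring

/-- The logarithms of the coordinates of `z` together with the values at `z` of the monomials
with exponents in `D`. -/
noncomputable def logMonomialLift (D : Finset (ι →₀ ℕ)) (z : ι → ℝ) : ι ⊕ D → ℝ :=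
  Sum.elim (fun i => Real.log (z i)) fun d => ∏ i, z i ^ (d : ι →₀ ℕ) i

lemma injOn_logMonomialLift (D : Finset (ι →₀ ℕ)) :
    InjOn (logMonomialLift D) {z : ι → ℝ | ∀ i, 0 < z i} := fun _ hz _ hw h =>
  funext fun i => Real.log_injOn_pos (hz i) (hw i) (congrFun h (.inl i))

variable [DecidableEq ι]

lemma isNondegZero_logMonomialLift {f : ι → MvPolynomial ι ℝ} {D : Finset (ι →₀ ℕ)}
    (hD : ∀ i, (f i).support ⊆ D) {z : ι → ℝ} (hz : ∀ i, 0 < z i) (hf : ∀ i, eval z (f i) = 0)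
    (hdet : (Matrix.of fun i l => eval z (pderiv l (f i))).det ≠ 0) :
    IsNondegZero (mixedSystem (fun (d : D) i => ((d : ι →₀ ℕ) i : ℝ)) (monomialForms f D)
      Finset.univ) (logMonomialLift D z) := by
  constructor
  · ext r
    rcases r with i | d
    · simpa [mixedSystem, monomialForms, logMonomialLift, eval_eq_sum_of_support_subset (hD i)]
        using hf i
    · have h : ∏ i, z i ^ (d : ι →₀ ℕ) i =
          Real.exp (∑ i, ((d : ι →₀ ℕ) i : ℝ) * Real.log (z i)) := by
        rw [Real.exp_sum]
        refine Finset.prod_congr rfl fun i _ => ?_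
        rw [Real.exp_nat_mul, Real.exp_log (hz i)]
      simp [mixedSystem, logMonomialLift, h, ← Real.exp_add]
  · rw [injective_fderiv_mixedSystem_iff, ne_eq, ← Matrix.exists_mulVec_eq_zero_iff]
    rintro ⟨ξ, hξ0, hξ⟩
    have hu : ∀ d : D, ξ (.inr d) =
        (∏ i, z i ^ (d : ι →₀ ℕ) i) * ∑ l, ((d : ι →₀ ℕ) l : ℝ) * ξ (.inl l) := fun d => by
      have h := congrFun hξ (.inr d)
      simp [Matrix.mulVec, dotProduct, mixedJacobian, logMonomialLift, Fintype.sum_sum_type,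
        apply_ite (eval _)] at h
      rw [Finset.mul_sum]
      rw [neg_add_eq_zero] at h
      rw [← h]
      exact Finset.sum_congr rfl fun l _ => by ring
    have hx : ∀ i, ∑ d : D, coeff d (f i) * ξ (.inr d) = 0 := fun i => by
      have h := congrFun hξ (.inl i)
      simpa [Matrix.mulVec, dotProduct, mixedJacobian, monomialForms, Fintype.sum_sum_type,
        pderiv_X, Pi.single_apply, apply_ite (eval _)] using h
    have hl : ∀ l, z l * ξ (.inl l) = 0 := by
      by_contra! hne
      obtain ⟨l₀, hl₀⟩ := hne
      refine hdet (Matrix.exists_mulVec_eq_zero_iff.1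
        ⟨fun l => z l * ξ (.inl l), fun h => hl₀ (congrFun h l₀), ?_⟩)
      ext i
      rw [Pi.zero_apply, ← hx i]
      simp only [Matrix.mulVec, dotProduct, Matrix.of_apply]
      calc ∑ l, eval z (pderiv l (f i)) * (z l * ξ (.inl l))
          = ∑ l, ∑ d : D, coeff d (f i) * ((d : ι →₀ ℕ) l *
              ∏ i, z i ^ (d : ι →₀ ℕ) i) * ξ (.inl l) := Finset.sum_congr rfl fun l _ => by
            rw [← Finset.sum_mul, ← mul_eval_pderiv_eq_sum (hD i)]; ring
        _ = _ := by
            rw [Finset.sum_comm]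
            refine Finset.sum_congr rfl fun d _ => ?_
            rw [hu, Finset.mul_sum, Finset.mul_sum]
            exact Finset.sum_congr rfl fun l _ => by ring
    have hl' : ∀ l, ξ (.inl l) = 0 := fun l => (mul_eq_zero.1 (hl l)).resolve_left (hz l).ne'
    refine hξ0 (funext fun r => ?_)
    rcases r with l | d
    · exact hl' l
    · simp [hu, hl']

theorem card_le_of_isNondegZero_of_pos [Nonempty ι] {f : ι → MvPolynomial ι ℝ}
    {D : Finset (ι →₀ ℕ)} (hD : ∀ i, (f i).support ⊆ D) {T : Finset (ι → ℝ)}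
    (hT : ∀ z ∈ T, (∀ i, 0 < z i) ∧ (∀ i, eval z (f i) = 0) ∧
      (Matrix.of fun i l => eval z (pderiv l (f i))).det ≠ 0) :
    T.card ≤ (Fintype.card ι + 1) ^ D.card * 2 ^ (D.card * (D.card - 1) / 2) := by
  classical
  have h := nondegZerosLE_mixedSystem (fun (d : D) i => ((d : ι →₀ ℕ) i : ℝ)) Finset.univ
    (monomialForms f D) (fun _ => 1) (totalDegree_monomialForms_le f D) (fun _ => le_rfl)
    (T.image (logMonomialLift D)) fun p hp => by
      obtain ⟨z, hz, rfl⟩ := Finset.mem_image.1 hp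
      obtain ⟨h1, h2, h3⟩ := hT z hz
      exact isNondegZero_logMonomialLift hD h1 h2 h3
  rw [Finset.card_image_of_injOn fun z hz w hw => injOn_logMonomialLift D (hT z hz).1
    (hT w hw).1] at h
  have hc : ((Finset.univ.map (Function.Embedding.inr : D ↪ ι ⊕ D))ᶜ).card = Fintype.card ι := by
    rw [Finset.card_compl]
    simp
  simpa only [Finset.prod_const_one, Finset.sum_const, smul_eq_mul, mul_one, one_mul, hc,
    Finset.card_univ, Fintype.card_coe, add_comm] using h

end Fewnomial

theorem stmt10 (n : ℕ) (f : Fin n → MvPolynomial (Fin n) ℝ)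
    (hjac : ∀ z : Fin n → ℂ,
      (∀ i, MvPolynomial.eval z ((f i).map (algebraMap ℝ ℂ)) = 0) →
      Matrix.det (Matrix.of fun i k =>
        MvPolynomial.eval z ((MvPolynomial.pderiv k (f i)).map (algebraMap ℝ ℂ))) ≠ 0)
    (k' : ℕ) (hk' : k' = {d : Fin n →₀ ℕ | ∃ i, d ∈ (f i).support}.ncard)
    (S : Set (Fin n → ℝ))
    (hS : S = {x | (∀ i, MvPolynomial.eval x (f i) = 0) ∧ ∀ i, 0 < x i}) :
    S.Finite ∧ S.ncard ≤ (n + 1) ^ k' * 2 ^ (k' * (k' - 1) / 2) := by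
  classical
  set D : Finset (Fin n →₀ ℕ) := Finset.univ.biUnion fun i => (f i).support with hD
  have hk : k' = D.card := by
    rw [hk', ← Set.ncard_coe_finset]
    congr 1
    ext d
    simp [hD]
  have hevalC : ∀ (x : Fin n → ℝ) (p : MvPolynomial (Fin n) ℝ),
      eval (fun i => (x i : ℂ)) (p.map (algebraMap ℝ ℂ)) = (eval x p : ℂ) := fun x p => by
    rw [eval_map]
    exact (eval₂_comp (algebraMap ℝ ℂ) x p).symm
  have hcard : ∀ T : Finset (Fin n → ℝ), (T : Set (Fin n → ℝ)) ⊆ S →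
      T.card ≤ (n + 1) ^ k' * 2 ^ (k' * (k' - 1) / 2) := by
    intro T hT
    rcases isEmpty_or_nonempty (Fin n) with hn | hn
    · exact (Finset.card_le_one_of_subsingleton T).trans (Nat.one_le_iff_ne_zero.2 (by positivity))
    · rw [hk]
      have h := card_le_of_isNondegZero_of_pos (f := f) (D := D) (T := T)
        (fun i => Finset.subset_biUnion_of_mem (fun i => (f i).support) (Finset.mem_univ i))
        fun z hz => ?_
      · simpa using h
      · have hzS := hT hz
        rw [hS] at hzS
        refine ⟨hzS.2, hzS.1, fun h0 => hjac (fun i => (z i : ℂ)) (fun i => ?_) ?_⟩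
        · rw [hevalC, hzS.1 i, Complex.ofReal_zero]
        · simp only [hevalC]
          have := RingHom.map_det (algebraMap ℝ ℂ) (Matrix.of fun i l => eval z (pderiv l (f i)))
          rw [h0, map_zero] at this
          exact this.symm
  have hfin : S.Finite := by
    by_contra hinf
    obtain ⟨T, hTS, hT⟩ := Set.Infinite.exists_subset_card_eq hinf
      ((n + 1) ^ k' * 2 ^ (k' * (k' - 1) / 2) + 1)
    have := hcard T hTS
    omega
  refine ⟨hfin, ?_⟩
  rw [Set.ncard_eq_toFinset_card S hfin]
  exact hcard _ (by simp)
end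

section
/- Let m, n ≥ 1, let F = (f₁,…,f_m) with f_i ∈ ℂ[x₁,…,xₙ], let Z_F ⊆ ℂⁿ be the common zero set of F, and let V_F be as defined below. Let S ⊂ ℂ be any finite set of cardinality at least m·V_F + 1. Then there exists (ε₁,…,εₙ) ∈ Sⁿ such that, setting f̃_i := f₁ + ε_i·f₂ + ⋯ + ε_i^{m−1}·f_m for i = 1,…,n and letting Z_{F̃} ⊆ ℂⁿ be the common zero set of f̃₁,…,f̃ₙ, every irreducible component of Z_{F̃} (with respect to the Zariski topology) is either an irreducible component of Z_F or a single point. -/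
open MeasureTheory

/-- The Newton polytope `Q_F`: convex hull of the origin, the standard basis
vectors, and all exponent vectors of the polynomials `f i`. -/
noncomputable def QF {n m : ℕ} {R : Type*} [CommSemiring R]
    (f : Fin m → MvPolynomial (Fin n) R) : Set (Fin n → ℝ) :=
  convexHull ℝ ({0} ∪ Set.range (fun j : Fin n => Pi.single j (1 : ℝ)) ∪
    {x | ∃ i d, d ∈ (f i).support ∧ x = fun j => (d j : ℝ)})

/-- `V_F := n! · vol(Q_F)`, the normalized volume of the Newton polytope. -/
noncomputable def VF {n m : ℕ} {R : Type*} [CommSemiring R]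
    (f : Fin m → MvPolynomial (Fin n) R) : ℝ :=
  (n.factorial : ℝ) * (volume (QF f)).toReal


/-- A subset of `ℂⁿ` is Zariski closed iff it is the common zero set of a
collection of polynomials. -/
def ZarClosed (n : ℕ) (C : Set (Fin n → ℂ)) : Prop :=
  ∃ T : Set (MvPolynomial (Fin n) ℂ), C = {x | ∀ g ∈ T, MvPolynomial.eval x g = 0}

/-- Irreducibility of a subset of `ℂⁿ` with respect to the Zariski topology. -/
def ZarIrred (n : ℕ) (W : Set (Fin n → ℂ)) : Prop :=
  W.Nonempty ∧ ∀ C₁ C₂ : Set (Fin n → ℂ), ZarClosed n C₁ → ZarClosed n C₂ →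
    W ⊆ C₁ ∪ C₂ → W ⊆ C₁ ∨ W ⊆ C₂

/-- `W` is an irreducible component of `Z`: a maximal irreducible subset of `Z`
which is closed in the subspace (Zariski) topology of `Z`. -/
def IsIrredCompOf (n : ℕ) (W Z : Set (Fin n → ℂ)) : Prop :=
  W ⊆ Z ∧ ZarIrred n W ∧ (∃ C, ZarClosed n C ∧ W = C ∩ Z) ∧
    ∀ W' : Set (Fin n → ℂ), W' ⊆ Z → ZarIrred n W' →
      (∃ C, ZarClosed n C ∧ W' = C ∩ Z) → W ⊆ W' → W = W'

theorem Polynomial.height_comap_C_add_one_le {R : Type*} [CommRing R] [IsNoetherianRing R]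
    (P : Ideal (Polynomial R)) [P.IsPrime] (h : P ≠ (P.comap C).map C) :
    (P.comap C).height + 1 ≤ P.height := by
  have hlies : P.LiesOver (P.comap (C : R →+* Polynomial R)) := ⟨rfl⟩
  have hle : (P.comap (C : R →+* Polynomial R)).map C ≤ P := Ideal.map_comap_le
  have hp : ((P.comap (C : R →+* Polynomial R)).map (C : R →+* Polynomial R)).IsPrime :=
    Ideal.isPrime_map_C_of_isPrime
  have h1 : ((P.comap (C : R →+* Polynomial R)).map (C : R →+* Polynomial R)).height + 1
      ≤ P.height :=
    Ideal.height_add_one_le_of_lt_of_isPrime (lt_of_le_of_ne hle (Ne.symm h))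
  have hl2 : ((P.comap (C : R →+* Polynomial R)).map (C : R →+* Polynomial R)).LiesOver
      (P.comap (C : R →+* Polynomial R)) :=
    ⟨le_antisymm Ideal.le_comap_map (Ideal.comap_mono hle)⟩
  refine le_trans ?_ h1
  gcongr
  rw [Ideal.height_eq_height_add_of_liesOver_of_hasGoingDown
    (P.comap (C : R →+* Polynomial R))
    (P := (P.comap (C : R →+* Polynomial R)).map (C : R →+* Polynomial R))]
  exact le_self_add

theorem Polynomial.height_comap_C_le {R : Type*} [CommRing R] [IsNoetherianRing R]
    (P : Ideal (Polynomial R)) [P.IsPrime] : (P.comap C).height ≤ P.height := by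
  have hlies : P.LiesOver (P.comap (C : R →+* Polynomial R)) := ⟨rfl⟩
  rw [Ideal.height_eq_height_add_of_liesOver_of_hasGoingDown
    (P.comap (C : R →+* Polynomial R)) (P := P)]
  exact le_self_add

/-- A prime ideal of a polynomial ring in `n` variables of height `h` admits at least `n - h`
variables which are algebraically independent modulo the ideal. -/
theorem MvPolynomial.exists_independent_variables {K : Type*} [Field K] :
    ∀ (n : ℕ) (q : Ideal (MvPolynomial (Fin n) K)) [q.IsPrime],
      ∃ B : Finset (Fin n), (n : ℕ∞) ≤ B.card + q.height ∧
        ∀ p ∈ q, (∀ a ∈ p.support, a.support ⊆ B) → p = 0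
  | 0, q, _ => by
    refine ⟨∅, by simp, fun p hp _ => ?_⟩
    by_contra h0
    have : p = C (coeff 0 p) := eq_C_of_isEmpty p
    have hc : coeff 0 p ≠ 0 := fun h => h0 (by rw [this, h, C_0])
    refine Ideal.IsPrime.ne_top ‹q.IsPrime› (Ideal.eq_top_of_isUnit_mem _ hp ?_)
    rw [this]
    exact (isUnit_iff_ne_zero.mpr hc).map C
  | n + 1, q, _ => by
    let φ := finSuccEquiv K n
    let Q : Ideal (Polynomial (MvPolynomial (Fin n) K)) := q.comap φ.symm.toRingEquiv
    have hQ : Q.IsPrime := Ideal.comap_isPrime _ _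
    have hQh : Q.height = q.height := RingEquiv.height_comap _ _
    have hmem : ∀ p, p ∈ q → φ p ∈ Q := fun p hp => by
      change φ.symm (φ p) ∈ q
      simpa using hp
    obtain ⟨B, hB, hBq⟩ := exists_independent_variables n (Q.comap Polynomial.C)
    have hsupp : ∀ (B' : Finset (Fin (n + 1))), (∀ j : Fin n, j.succ ∈ B' → j ∈ B) →
        ∀ p : MvPolynomial (Fin (n + 1)) K, (∀ a ∈ p.support, a.support ⊆ B') →
        ∀ i, ∀ a ∈ ((φ p).coeff i).support, a.support ⊆ B := by
      intro B' hB' p hp i a ha j hj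
      have h1 := hp _ (mem_support_coeff_finSuccEquiv.mp ha)
      exact hB' j (h1 (by simpa using hj))
    by_cases hc : Q = (Q.comap Polynomial.C).map Polynomial.C
    · refine ⟨insert 0 (B.map (Fin.succEmb n)), ?_, fun p hp hps => ?_⟩
      · have h1 := Polynomial.height_comap_C_le Q
        rw [Finset.card_insert_of_notMem (by simp), Finset.card_map, ← hQh]
        push_cast
        calc (n : ℕ∞) + 1 ≤ B.card + (Q.comap Polynomial.C).height + 1 := by gcongr
          _ ≤ B.card + Q.height + 1 := by gcongr
          _ = _ := by ring
      · have h1 := hmem p hp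
        rw [hc, Ideal.mem_map_C_iff] at h1
        have h2 : φ p = 0 := Polynomial.ext fun i =>
          hBq _ (h1 i) (hsupp _ (fun j hj => by simpa using hj) p hps i)
        simpa using h2
    · refine ⟨B.map (Fin.succEmb n), ?_, fun p hp hps => ?_⟩
      · have h1 := Polynomial.height_comap_C_add_one_le Q hc
        rw [Finset.card_map, ← hQh]
        push_cast
        calc (n : ℕ∞) + 1 ≤ B.card + (Q.comap Polynomial.C).height + 1 := by gcongr
          _ = B.card + ((Q.comap Polynomial.C).height + 1) := by ring
          _ ≤ _ := by gcongr
      · have h0 : ∀ i, i ≠ 0 → (φ p).coeff i = 0 := by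
          intro i hi
          rw [← support_eq_empty]
          refine Finset.eq_empty_of_forall_notMem fun a ha => ?_
          have h1 := hps _ (mem_support_coeff_finSuccEquiv.mp ha)
          have h2 : (0 : Fin (n + 1)) ∈ B.map (Fin.succEmb n) := h1 (by simpa using hi)
          simp at h2
        have hφ : φ p = Polynomial.C ((φ p).coeff 0) := by
          ext1 i
          rcases eq_or_ne i 0 with rfl | hi
          · simp
          · rw [h0 i hi, Polynomial.coeff_C, if_neg hi]
        have h1 := hmem p hp
        rw [hφ] at h1
        have h2 := hBq _ (Ideal.mem_comap.mpr h1) (hsupp _ (fun j hj => by simpa using hj) p hps 0)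
        rw [h2, map_zero] at hφ
        simpa using hφ

section dilate

open scoped Pointwise

/-- Exponent vectors lying in the dilate `d • Q`. -/
def dilateExponents {n : ℕ} (Q : Set (Fin n → ℝ)) (d : ℕ) : Set (Fin n →₀ ℕ) :=
  {a | (fun j => (a j : ℝ)) ∈ (d : ℝ) • Q}

theorem finite_dilateExponents {n : ℕ} {Q : Set (Fin n → ℝ)} (hQ : Bornology.IsBounded Q)
    (d : ℕ) : (dilateExponents Q d).Finite := by
  obtain ⟨M, hM⟩ := (hQ.smul₀ (d : ℝ)).exists_norm_le
  refine Set.Finite.subset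
    (Set.finite_Iic (Finsupp.equivFunOnFinite.symm fun _ : Fin n => ⌊M⌋₊)) fun a ha j => ?_
  have h1 := (norm_le_pi_norm _ j).trans (hM (fun j => (a j : ℝ)) ha)
  simp only [Real.norm_natCast] at h1
  simpa using Nat.le_floor h1

theorem add_mem_dilateExponents {n : ℕ} {Q : Set (Fin n → ℝ)} (hQ : Convex ℝ Q) {c d : ℕ}
    {a b : Fin n →₀ ℕ} (ha : a ∈ dilateExponents Q c) (hb : b ∈ dilateExponents Q d) :
    a + b ∈ dilateExponents Q (c + d) := by
  have h := hQ.add_smul (Nat.cast_nonneg c) (Nat.cast_nonneg d)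
  have : (fun j => ((a + b) j : ℝ)) = (fun j => (a j : ℝ)) + fun j => (b j : ℝ) := by
    ext j; simp
  simp only [dilateExponents, Set.mem_ofPred_eq, this, Nat.cast_add, h]
  exact Set.add_mem_add ha hb

theorem mem_dilateExponents_of_degree_le {n : ℕ} {Q : Set (Fin n → ℝ)} (hQ : Convex ℝ Q)
    (h0 : 0 ∈ Q) (h1 : ∀ j, Pi.single j (1 : ℝ) ∈ Q) {a : Fin n →₀ ℕ} {d : ℕ}
    (ha : a.degree ≤ d) : a ∈ dilateExponents Q d := by
  rcases Nat.eq_zero_or_pos d with rfl | hd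
  · have : a = 0 := by simpa [Finsupp.degree_eq_zero_iff] using ha
    subst this
    exact ⟨0, h0, by ext; simp⟩
  have hd' : (0 : ℝ) < d := by exact_mod_cast hd
  have hs : ∑ j, (a j : ℝ) = a.degree := by
    rw [Finsupp.degree_eq_sum]; push_cast; rfl
  refine ⟨∑ o : Option (Fin n), (o.elim (1 - (a.degree : ℝ) / d) fun j => (a j : ℝ) / d) •
    o.elim (0 : Fin n → ℝ) fun j => Pi.single j (1 : ℝ), hQ.sum_mem ?_ ?_ ?_, ?_⟩
  · rintro (_ | j) -
    · have : (a.degree : ℝ) ≤ d := by exact_mod_cast ha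
      simpa using div_le_one_of_le₀ this hd'.le
    · simp only [Option.elim_some]; positivity
  · simp [Fintype.sum_option, ← Finset.sum_div, hs]
  · rintro (_ | j) -
    · exact h0
    · exact h1 j
  · ext k
    simp [Fintype.sum_option, Finset.sum_apply, Pi.single_apply]
    field_simp

open Filter Topology in
/-- Counting lattice points of dilates bounds the volume from below. -/
theorem le_factorial_mul_volume {n : ℕ} {Q : Set (Fin n → ℝ)} (hQ : Convex ℝ Q)
    (hb : Bornology.IsBounded Q) (hm : MeasurableSet Q) (r c : ℕ)
    (h : ∀ d : ℕ, r * (d + n).choose n ≤ (dilateExponents Q (d + c)).ncard) :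
    (r : ℝ) ≤ n.factorial * (volume Q).toReal := by
  have hlim := tendsto_card_div_pow_atTop_volume Q hb hm (hQ.addHaar_frontier volume)
  have hlim1 := hlim.comp (tendsto_add_atTop_nat (c + 1))
  have hlim2 : Tendsto (fun d : ℕ => (r : ℝ) / n.factorial *
      (((d + 1 : ℕ) : ℝ) / ((d + 1 : ℕ) + c : ℕ)) ^ n) atTop (𝓝 (r / n.factorial * 1 ^ n)) := by
    refine Tendsto.const_mul _ (Tendsto.pow ?_ _)
    have := (tendsto_natCast_div_add_atTop (𝕜 := ℝ) (c : ℝ)).comp (tendsto_add_atTop_nat 1)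
    refine this.congr fun d => ?_
    simp
  have hle := le_of_tendsto_of_tendsto' hlim2 hlim1 fun d => ?_
  · rw [one_pow, mul_one, div_le_iff₀ (by positivity)] at hle
    rw [mul_comm]
    exact hle
  simp only [Function.comp_apply, Fintype.card_fin]
  have hD : (0 : ℝ) < (d + (c + 1) : ℕ) := by positivity
  have hDe : (d + 1 : ℕ) + c = d + (c + 1) := by ring
  have hcard : (dilateExponents Q (d + (c + 1))).ncard ≤
      Nat.card ↑(Q ∩ ((d + (c + 1) : ℕ) : ℝ)⁻¹ •
        (Submodule.span ℤ (Set.range (Pi.basisFun ℝ (Fin n))) : Set (Fin n → ℝ))) := by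
    refine Set.ncard_le_ncard_of_injOn
      (fun a : Fin n →₀ ℕ => ((d + (c + 1) : ℕ) : ℝ)⁻¹ • fun j => (a j : ℝ)) ?_ ?_ ?_
    · rintro a ⟨x, hx, hxa⟩
      refine ⟨?_, Set.smul_mem_smul_set ?_⟩
      · simp only at hxa ⊢
        rw [← hxa, inv_smul_smul₀ hD.ne']
        exact hx
      · rw [SetLike.mem_coe, Module.Basis.mem_span_iff_repr_mem]
        intro j
        exact ⟨a j, by simp⟩
    · intro a _ b _ hab
      have := smul_right_injective _ (inv_ne_zero hD.ne') hab
      ext j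
      exact_mod_cast congrFun this j
    · rw [← Submodule.coe_pointwise_smul, ZSpan.smul _ (inv_ne_zero hD.ne')]
      exact ZSpan.setFinite_inter _ hb
  have h1 : r * (d + 1) ^ n ≤ (dilateExponents Q (d + (c + 1))).ncard * n.factorial := by
    have h2 := h (d + 1)
    have h3 : (d + 1) ^ n ≤ (d + 1 + n).choose n * n.factorial := by
      rw [mul_comm, ← Nat.ascFactorial_eq_factorial_mul_choose]
      exact (Nat.pow_le_pow_left (by omega) _).trans (Nat.pow_succ_le_ascFactorial _ _)
    calc r * (d + 1) ^ n ≤ r * ((d + 1 + n).choose n * n.factorial) := by gcongr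
      _ = r * (d + 1 + n).choose n * n.factorial := by ring
      _ ≤ _ := by rw [← hDe]; gcongr
  rw [hDe, div_pow, div_mul_div_comm, div_le_div_iff₀ (by positivity) (by positivity)]
  have h1' : (r : ℝ) * (d + 1 : ℕ) ^ n ≤
      (dilateExponents Q (d + (c + 1))).ncard * n.factorial := by exact_mod_cast h1
  have hcard' := (Nat.cast_le (α := ℝ)).mpr hcard
  calc _ ≤ ((dilateExponents Q (d + (c + 1))).ncard * n.factorial : ℝ) *
        ((d + (c + 1) : ℕ) : ℝ) ^ n := by gcongr
    _ = (dilateExponents Q (d + (c + 1))).ncard *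
      (n.factorial * ((d + (c + 1) : ℕ) : ℝ) ^ n) := by ring
    _ ≤ _ := by gcongr

end dilate

/-- The Hilbert function of `A ⧸ I` with respect to a family of subspaces `L d` of `A`. -/
noncomputable def hilbertFun {K A : Type*} [Field K] [CommRing A] [Algebra K A]
    (L : ℕ → Submodule K A) (I : Ideal A) (d : ℕ) : ℕ :=
  Module.finrank K ((L d).map (Ideal.Quotient.mkₐ K I).toLinearMap)

section hilbertFun

variable {K A : Type*} [Field K] [CommRing A] [Algebra K A]
  {L : ℕ → Submodule K A}

theorem hilbertFun_mono (hfin : ∀ d, Module.Finite K (L d)) {I J : Ideal A} (h : I ≤ J) (d : ℕ) :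
    hilbertFun L J d ≤ hilbertFun L I d := by
  have := hfin d
  have heq : (L d).map (Ideal.Quotient.mkₐ K J).toLinearMap =
      ((L d).map (Ideal.Quotient.mkₐ K I).toLinearMap).map
        (Ideal.Quotient.factorₐ K h).toLinearMap := by
    rw [← Submodule.map_comp, ← AlgHom.comp_toLinearMap, Ideal.Quotient.factorₐ_comp_mk]
  rw [hilbertFun, heq]
  exact Submodule.finrank_map_le _ _

/-- Cutting by a non-zero-divisor `g` drops the Hilbert function by at least its shift. -/
theorem hilbertFun_succ_add_le (hfin : ∀ d, Module.Finite K (L d)) {I J : Ideal A} (h : I ≤ J)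
    {g : A} (hgL : ∀ d, ∀ p ∈ L d, g * p ∈ L (d + 1)) (hgJ : g ∈ J)
    (hg : ∀ p, g * p ∈ I → p ∈ I) (d : ℕ) :
    hilbertFun L J (d + 1) + hilbertFun L I d ≤ hilbertFun L I (d + 1) := by
  have := hfin d
  have := hfin (d + 1)
  let U := (L (d + 1)).map (Ideal.Quotient.mkₐ K I).toLinearMap
  let V := (L d).map (Ideal.Quotient.mkₐ K I).toLinearMap
  let φ : (A ⧸ I) →ₗ[K] (A ⧸ J) := (Ideal.Quotient.factorₐ K h).toLinearMap
  have heq : (L (d + 1)).map (Ideal.Quotient.mkₐ K J).toLinearMap = U.map φ := by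
    rw [← Submodule.map_comp, ← AlgHom.comp_toLinearMap, Ideal.Quotient.factorₐ_comp_mk]
  have hrn := (φ.domRestrict U).finrank_range_add_finrank_ker
  rw [LinearMap.range_domRestrict, ← heq] at hrn
  rw [hilbertFun, hilbertFun, hilbertFun, ← hrn]
  gcongr
  let ψ : (A ⧸ I) →ₗ[K] (A ⧸ I) := LinearMap.mulLeft K (Ideal.Quotient.mk I g)
  have hψU : ∀ v : V, ψ v ∈ U := by
    rintro ⟨_, p, hp, rfl⟩
    exact ⟨g * p, hgL d p hp, by simp [ψ]⟩
  let θ : V →ₗ[K] LinearMap.ker (φ.domRestrict U) :=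
    ((ψ.domRestrict V).codRestrict U hψU).codRestrict _ (by
      rintro ⟨_, p, hp, rfl⟩
      have : ψ ((Ideal.Quotient.mkₐ K I) p) = Ideal.Quotient.mk I (g * p) := by simp [ψ]
      rw [LinearMap.mem_ker]
      change φ (ψ ((Ideal.Quotient.mkₐ K I) p)) = 0
      rw [this]
      change Ideal.Quotient.mk J (g * p) = 0
      exact Ideal.Quotient.eq_zero_iff_mem.mpr (J.mul_mem_right _ hgJ))
  refine LinearMap.finrank_le_finrank_of_injective (f := θ) ?_
  rw [injective_iff_map_eq_zero]
  rintro ⟨_, p, hp, rfl⟩ h0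
  have h1 : ψ ((Ideal.Quotient.mkₐ K I) p) = 0 :=
    congrArg Subtype.val (congrArg Subtype.val h0)
  have h2 : Ideal.Quotient.mk I (g * p) = 0 := by simpa [ψ] using h1
  ext1
  exact Ideal.Quotient.eq_zero_iff_mem.mpr (hg p (Ideal.Quotient.eq_zero_iff_mem.mp h2))

theorem sum_hilbertFun_le (hfin : ∀ d, Module.Finite K (L d)) {I J : Ideal A} (h : I ≤ J)
    {g : A} (hgL : ∀ d, ∀ p ∈ L d, g * p ∈ L (d + 1)) (hgJ : g ∈ J)
    (hg : ∀ p, g * p ∈ I → p ∈ I) (d : ℕ) :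
    ∑ i ∈ Finset.range (d + 1), hilbertFun L J i ≤ hilbertFun L I d := by
  induction d with
  | zero => simpa using hilbertFun_mono hfin h 0
  | succ d ih =>
    rw [Finset.sum_range_succ]
    have := hilbertFun_succ_add_le hfin h hgL hgJ hg d
    omega

theorem sum_range_choose_add (e d : ℕ) :
    ∑ i ∈ Finset.range (d + 1), (i + e).choose e = (d + (e + 1)).choose (e + 1) := by
  induction d with
  | zero => simp
  | succ d ih =>
    rw [Finset.sum_range_succ, ih, show d + 1 + (e + 1) = (d + 1 + e) + 1 by ring,
      Nat.choose_succ_succ, add_comm]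
    congr 2
    ring

/-- The Hilbert function of `A ⧸ I` grows at least like `r` times that of a polynomial ring in
`e` variables. -/
def HilbertGrowth (L : ℕ → Submodule K A) (I : Ideal A) (r e : ℕ) : Prop :=
  ∃ c, ∀ d, r * (d + e).choose e ≤ hilbertFun L I (d + c)

theorem HilbertGrowth.of_nonZeroDivisor (hfin : ∀ d, Module.Finite K (L d)) {I J : Ideal A}
    (h : I ≤ J) {g : A} (hgL : ∀ d, ∀ p ∈ L d, g * p ∈ L (d + 1)) (hgJ : g ∈ J)
    (hg : ∀ p, g * p ∈ I → p ∈ I) {r e : ℕ} (H : HilbertGrowth L J r e) :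
    HilbertGrowth L I r (e + 1) := by
  obtain ⟨c, hc⟩ := H
  refine ⟨c, fun d => ?_⟩
  calc r * (d + (e + 1)).choose (e + 1)
      = ∑ i ∈ Finset.range (d + 1), r * (i + e).choose e := by
        rw [← sum_range_choose_add, Finset.mul_sum]
    _ ≤ ∑ i ∈ Finset.range (d + 1), hilbertFun L J (i + c) := Finset.sum_le_sum fun i _ => hc i
    _ ≤ ∑ i ∈ Finset.range (c + (d + 1)), hilbertFun L J i := by
        rw [Finset.sum_range_add _ c (d + 1)]
        simp [add_comm]
    _ ≤ hilbertFun L I (d + c) := by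
        rw [show c + (d + 1) = d + c + 1 by ring]
        exact sum_hilbertFun_le hfin h hgL hgJ hg _

end hilbertFun

/-- Exponent vectors supported in `B` of degree at most `d`. -/
noncomputable def boundedExponents {σ : Type*} [DecidableEq σ] (B : Finset σ) (d : ℕ) :
    Finset (σ →₀ ℕ) :=
  (Finset.range (d + 1)).biUnion fun i => B.finsuppAntidiag i

theorem mem_boundedExponents {σ : Type*} [DecidableEq σ] {B : Finset σ} {d : ℕ} {a : σ →₀ ℕ} :
    a ∈ boundedExponents B d ↔ a.degree ≤ d ∧ a.support ⊆ B := by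
  simp only [boundedExponents, Finset.mem_biUnion, Finset.mem_range, Finset.mem_finsuppAntidiag]
  constructor
  · rintro ⟨i, hi, hs, hB⟩
    refine ⟨?_, hB⟩
    rw [Finsupp.degree_apply, Finset.sum_subset hB (by simp), hs]
    omega
  · rintro ⟨hd, hB⟩
    refine ⟨_, Nat.lt_succ_of_le hd, ?_, hB⟩
    rw [Finsupp.degree_apply, Finset.sum_subset hB (by simp)]

theorem card_boundedExponents {σ : Type*} [DecidableEq σ] (B : Finset σ) (d : ℕ) :
    (boundedExponents B d).card = (d + B.card).choose B.card := by
  rw [boundedExponents, Finset.card_biUnion]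
  · simp only [Finset.card_finsuppAntidiag_nat_eq_choose]
    rcases Nat.eq_zero_or_pos B.card with h | h
    · rw [h, Finset.sum_range_succ']
      simp
    · obtain ⟨e, he⟩ := Nat.exists_eq_add_of_le' h
      rw [he, ← sum_range_choose_add]
      refine Finset.sum_congr rfl fun i _ => ?_
      rw [show e + 1 + i - 1 = i + e by omega]
      exact Nat.choose_symm_add
  · intro i _ j _ hij
    rw [Function.onFun, Finset.disjoint_left]
    intro a ha hb
    rw [Finset.mem_finsuppAntidiag] at ha hb
    exact hij (ha.1.symm.trans hb.1)

open MvPolynomial in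
/-- Pairwise incomparable primes each contribute to the growth of the Hilbert function of their
intersection. -/
theorem HilbertGrowth.of_primes {K σ : Type*} [Field K] [DecidableEq σ]
    {L : ℕ → Submodule K (MvPolynomial σ K)} (hfin : ∀ d, Module.Finite K (L d))
    (hmul : ∀ c d, ∀ p ∈ L c, ∀ q ∈ L d, p * q ∈ L (c + d))
    (hdeg : ∀ d a, a.degree ≤ d → monomial a 1 ∈ L d)
    (P : Finset (Ideal (MvPolynomial σ K))) (hP : ∀ q ∈ P, q.IsPrime)
    (hinc : ∀ q ∈ P, ∀ q' ∈ P, q ≤ q' → q = q') (e : ℕ)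
    (hB : ∀ q ∈ P, ∃ B : Finset σ, B.card = e ∧
      ∀ p ∈ q, (∀ a ∈ p.support, a.support ⊆ B) → p = 0) :
    HilbertGrowth L (sInf (P : Set (Ideal (MvPolynomial σ K)))) P.card e := by
  classical
  have hle : ∀ d, ∀ p : MvPolynomial σ K, p.totalDegree ≤ d → p ∈ L d := by
    intro d p hp
    rw [p.as_sum]
    refine Submodule.sum_mem _ fun a ha => ?_
    rw [← mul_one (coeff a p), ← smul_eq_mul, ← smul_monomial]
    refine Submodule.smul_mem _ _ (hdeg _ _ ((le_totalDegree ha).trans hp))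
  have hsep : ∀ q ∈ P, ∃ h, h ∉ q ∧ ∀ q' ∈ P, q' ≠ q → h ∈ q' := by
    intro q hq
    have := hP q hq
    have h1 : ¬ (∏ q' ∈ P.erase q, q') ≤ q := by
      rw [Ideal.IsPrime.prod_le (hP q hq)]
      rintro ⟨q', hq', hle⟩
      rw [Finset.mem_erase] at hq'
      exact hq'.1 (hinc q' hq'.2 q hq hle)
    obtain ⟨h, hh, hhq⟩ := SetLike.not_le_iff_exists.mp h1
    refine ⟨h, hhq, fun q' hq' hne => ?_⟩
    exact (Ideal.prod_le_inf.trans (Finset.inf_le (Finset.mem_erase.mpr ⟨hne, hq'⟩))) hh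
  choose! h hhq hh using hsep
  choose! B hBe hBq using hB
  refine ⟨P.sup fun q => (h q).totalDegree, fun d => ?_⟩
  set c := P.sup fun q => (h q).totalDegree
  have := hfin (d + c)
  let I := sInf (P : Set (Ideal (MvPolynomial σ K)))
  let T : P → Submodule K (MvPolynomial σ K) := fun q =>
    restrictSupport K (boundedExponents (B q) d : Set (σ →₀ ℕ))
  have hTfin : ∀ q, Module.Finite K (T q) := fun q =>
    Module.Finite.of_basis (basisRestrictSupport K _)
  have hTrank : ∀ q, Module.finrank K (T q) = (d + e).choose e := fun q => by
    rw [Module.finrank_eq_card_basis (basisRestrictSupport K _)]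
    simp [card_boundedExponents, hBe q q.2]
  let Φ : ((q : P) → T q) →ₗ[K] MvPolynomial σ K :=
    ∑ q : P, (LinearMap.mulRight K (h q)) ∘ₗ (T q).subtype ∘ₗ LinearMap.proj q
  have hΦ : ∀ v, Φ v = ∑ q : P, (v q : MvPolynomial σ K) * h q := fun v => by
    simp [Φ, LinearMap.sum_apply]
  let Ψ := ((Ideal.Quotient.mkₐ K I).toLinearMap ∘ₗ Φ).codRestrict
    ((L (d + c)).map (Ideal.Quotient.mkₐ K I).toLinearMap) (fun v => by
      refine ⟨Φ v, ?_, rfl⟩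
      rw [SetLike.mem_coe, hΦ]
      refine Submodule.sum_mem _ fun q _ => hmul _ _ _ ?_ _ (hle _ _ (Finset.le_sup (f := fun q => (h q).totalDegree) q.2))
      refine hle _ _ (Finset.sup_le fun a ha => ?_)
      exact (mem_boundedExponents.mp ((v q).2 ha)).1)
  have hinj : Function.Injective Ψ := by
    rw [injective_iff_map_eq_zero]
    intro v hv
    have h0 : Φ v ∈ I := Ideal.Quotient.eq_zero_iff_mem.mp (congrArg Subtype.val hv)
    ext1 q
    have h1 : Φ v ∈ (q : Ideal (MvPolynomial σ K)) := sInf_le (Finset.mem_coe.mpr q.2) h0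
    rw [hΦ, ← Finset.add_sum_erase _ _ (Finset.mem_univ q)] at h1
    have h2 : ∑ q' ∈ Finset.univ.erase q, (v q' : MvPolynomial σ K) * h q' ∈
        (q : Ideal (MvPolynomial σ K)) := by
      refine Ideal.sum_mem _ fun q' hq' => Ideal.mul_mem_left _ _ (hh q' q'.2 q q.2 ?_)
      exact fun h => (Finset.mem_erase.mp hq').1 (Subtype.ext h).symm
    have h3 := (Ideal.add_mem_iff_left _ h2).mp h1
    have h4 := ((hP q q.2).mem_or_mem h3).resolve_right (hhq q q.2)
    ext1
    exact hBq q q.2 _ h4 fun a ha => (mem_boundedExponents.mp ((v q).2 ha)).2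
  have hfinal := LinearMap.finrank_le_finrank_of_injective hinj
  rw [Module.finrank_pi_fintype, Finset.sum_congr rfl fun q _ => hTrank q] at hfinal
  simpa [hilbertFun] using hfinal

section pencil

variable {n m : ℕ} (f : Fin m → MvPolynomial (Fin n) ℂ)

/-- The member `f₁ + t f₂ + ⋯ + t ^ (m - 1) fₘ` of the pencil spanned by `f`. -/
noncomputable def pencil (t : ℂ) : MvPolynomial (Fin n) ℂ :=
  ∑ j : Fin m, MvPolynomial.C (t ^ (j : ℕ)) * f j

theorem card_filter_pencil_mem_le (hm : 1 ≤ m) (q : Ideal (MvPolynomial (Fin n) ℂ)) [q.IsPrime]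
    (hq : ¬ Ideal.span (Set.range f) ≤ q) (S : Finset ℂ) [DecidablePred fun t => pencil f t ∈ q] :
    (S.filter fun t => pencil f t ∈ q).card ≤ m - 1 := by
  by_contra! hlt
  let G : Polynomial (MvPolynomial (Fin n) ℂ ⧸ q) :=
    ∑ j : Fin m, Polynomial.C (Ideal.Quotient.mk q (f j)) * Polynomial.X ^ (j : ℕ)
  have hdeg : G.natDegree ≤ m - 1 :=
    Polynomial.natDegree_sum_le_of_forall_le _ _ fun j _ =>
      (Polynomial.natDegree_C_mul_X_pow_le _ _).trans (by omega)
  let ι : ℂ → MvPolynomial (Fin n) ℂ ⧸ q := algebraMap ℂ _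
  have hι : Function.Injective ι := (algebraMap ℂ (MvPolynomial (Fin n) ℂ ⧸ q)).injective
  have heval : ∀ t, G.eval (ι t) = Ideal.Quotient.mk q (pencil f t) := by
    intro t
    have : ι t = Ideal.Quotient.mk q (MvPolynomial.C t) := rfl
    simp [G, pencil, Polynomial.eval_finsetSum, this, mul_comm]
  have hG : G = 0 := by
    classical
    refine Polynomial.eq_zero_of_natDegree_lt_card_of_eval_eq_zero' G
      ((S.filter fun t => pencil f t ∈ q).image ι) ?_ ?_
    · intro x hx
      obtain ⟨t, ht, rfl⟩ := Finset.mem_image.mp hx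
      rw [heval]
      exact Ideal.Quotient.eq_zero_iff_mem.mpr (Finset.mem_filter.mp ht).2
    · rw [Finset.card_image_of_injective _ hι]
      omega
  refine hq (Ideal.span_le.mpr ?_)
  rintro _ ⟨j, rfl⟩
  have h1 : G.coeff j = Ideal.Quotient.mk q (f j) := by
    simp [G, Polynomial.finsetSum_coeff, Polynomial.coeff_X_pow, Fin.val_inj]
  rw [hG, Polynomial.coeff_zero] at h1
  exact Ideal.Quotient.eq_zero_iff_mem.mp h1.symm

theorem exists_pencil_notMem (hm : 1 ≤ m) (P : Finset (Ideal (MvPolynomial (Fin n) ℂ)))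
    (hP : ∀ q ∈ P, q.IsPrime) (hPf : ∀ q ∈ P, ¬ Ideal.span (Set.range f) ≤ q) (S : Finset ℂ)
    (hS : P.card * (m - 1) < S.card) : ∃ t ∈ S, ∀ q ∈ P, pencil f t ∉ q := by
  classical
  by_contra! h
  have hsub : S ⊆ P.biUnion fun q => S.filter fun t => pencil f t ∈ q := fun t ht => by
    obtain ⟨q, hq, hmem⟩ := h t ht
    exact Finset.mem_biUnion.mpr ⟨q, hq, Finset.mem_filter.mpr ⟨ht, hmem⟩⟩
  refine absurd ((Finset.card_le_card hsub).trans (Finset.card_biUnion_le_card_mul _ _ (m - 1)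
    fun q hq => ?_)) (not_le.mpr hS)
  have := hP q hq
  exact card_filter_pencil_mem_le f hm q (hPf q hq) S

theorem convex_QF : Convex ℝ (QF f) := convex_convexHull _ _

theorem finite_generators_QF :
    ({0} ∪ Set.range (fun j : Fin n => Pi.single j (1 : ℝ)) ∪
    {x : Fin n → ℝ | ∃ i d, d ∈ (f i).support ∧ x = fun j => (d j : ℝ)}).Finite := by
  refine ((Set.finite_singleton _).union (Set.finite_range _)).union ?_
  have : {x : Fin n → ℝ | ∃ i d, d ∈ (f i).support ∧ x = fun j => (d j : ℝ)} =
      ⋃ i, (fun (d : Fin n →₀ ℕ) (j : Fin n) => (d j : ℝ)) '' (f i).support := by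
    ext x
    simp [eq_comm]
  rw [this]
  exact Set.finite_iUnion fun i => (Finset.finite_toSet _).image _

/-- Polynomials whose exponents lie in the dilated Newton polytope `d • QF f`. -/
noncomputable def newtonFiltration (d : ℕ) : Submodule ℂ (MvPolynomial (Fin n) ℂ) :=
  MvPolynomial.restrictSupport ℂ (dilateExponents (QF f) d)

theorem isBounded_QF : Bornology.IsBounded (QF f) :=
  (isBounded_convexHull).mpr (finite_generators_QF f).isBounded

theorem finite_newtonFiltration (d : ℕ) : Module.Finite ℂ (newtonFiltration f d) := by
  have := (finite_dilateExponents (isBounded_QF f) d).to_subtype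
  exact Module.Finite.of_basis (MvPolynomial.basisRestrictSupport ℂ _)

theorem finrank_newtonFiltration (d : ℕ) :
    Module.finrank ℂ (newtonFiltration f d) = (dilateExponents (QF f) d).ncard :=
  Module.finrank_eq_nat_card_basis (MvPolynomial.basisRestrictSupport ℂ _)

theorem mul_mem_newtonFiltration (c d : ℕ) (p : MvPolynomial (Fin n) ℂ)
    (hp : p ∈ newtonFiltration f c) (q : MvPolynomial (Fin n) ℂ) (hq : q ∈ newtonFiltration f d) :
    p * q ∈ newtonFiltration f (c + d) := by
  classical
  refine (MvPolynomial.mem_restrictSupport_iff ℂ).mpr fun a ha => ?_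
  obtain ⟨b, hb, b', hb', rfl⟩ := Finset.mem_add.mp (MvPolynomial.support_mul p q ha)
  exact add_mem_dilateExponents (convex_QF f) (hp hb) (hq hb')

theorem monomial_mem_newtonFiltration (d : ℕ) (a : Fin n →₀ ℕ) (ha : a.degree ≤ d) :
    MvPolynomial.monomial a 1 ∈ newtonFiltration f d := by
  refine (MvPolynomial.monomial_mem_restrictSupport ℂ).mpr (Or.inl ?_)
  exact mem_dilateExponents_of_degree_le (convex_QF f)
    (subset_convexHull _ _ (Or.inl (Or.inl rfl)))
    (fun j => subset_convexHull _ _ (Or.inl (Or.inr ⟨j, rfl⟩))) ha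

theorem pencil_mem_newtonFiltration (t : ℂ) : pencil f t ∈ newtonFiltration f 1 := by
  refine Submodule.sum_mem _ fun j _ => ?_
  rw [← MvPolynomial.smul_eq_C_mul]
  refine Submodule.smul_mem _ _ ((MvPolynomial.mem_restrictSupport_iff ℂ).mpr fun a ha => ?_)
  exact ⟨_, subset_convexHull _ _ (Or.inr ⟨j, a, ha, rfl⟩), by simp⟩

theorem HilbertGrowth.le_VF {r : ℕ} (h : HilbertGrowth (newtonFiltration f) ⊥ r n) :
    (r : ℝ) ≤ VF f := by
  obtain ⟨c, hc⟩ := h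
  refine le_factorial_mul_volume (convex_QF f) (isBounded_QF f)
    ((finite_generators_QF f).isCompact_convexHull _).isClosed.measurableSet r c fun d => ?_
  have := finite_newtonFiltration f (d + c)
  rw [← finrank_newtonFiltration]
  exact (hc d).trans (Submodule.finrank_map_le _ _)

/-- Minimal primes over `g` which do not contain all the `f i`. -/
def extraneousPrimes {k : ℕ} (g : Fin k → MvPolynomial (Fin n) ℂ) :
    Set (Ideal (MvPolynomial (Fin n) ℂ)) :=
  {q ∈ (Ideal.span (Set.range g)).minimalPrimes | ¬ Ideal.span (Set.range f) ≤ q}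

theorem finite_extraneousPrimes {k : ℕ} (g : Fin k → MvPolynomial (Fin n) ℂ) :
    (extraneousPrimes f g).Finite :=
  (Ideal.finite_minimalPrimes_of_isNoetherianRing _ _).subset fun _ h => h.1

theorem HilbertGrowth.extraneousPrimes {k : ℕ} (g : Fin k → MvPolynomial (Fin n) ℂ) :
    HilbertGrowth (newtonFiltration f) (sInf (extraneousPrimes f g))
      (extraneousPrimes f g).ncard (n - k) := by
  have hfin := finite_extraneousPrimes f g
  have hmem : ∀ {q}, q ∈ hfin.toFinset → q ∈ (Ideal.span (Set.range g)).minimalPrimes :=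
    fun hq => (hfin.mem_toFinset.mp hq).1
  have h := HilbertGrowth.of_primes (finite_newtonFiltration f) (mul_mem_newtonFiltration f)
    (monomial_mem_newtonFiltration f) hfin.toFinset
    (fun q hq => (hmem hq).1.1)
    (fun q hq q' hq' hle => le_antisymm hle ((hmem hq').2 (hmem hq).1 hle)) (n - k) ?_
  · rwa [hfin.coe_toFinset, ← Set.ncard_eq_toFinset_card _ hfin] at h
  · intro q hq
    have := (hmem hq).1.1
    obtain ⟨B, hB, hBq⟩ := MvPolynomial.exists_independent_variables n q
    have hht : q.height ≤ k := by
      refine (Ideal.height_le_card_of_mem_minimalPrimes_span (Set.finite_range g)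
        (hmem hq)).trans ?_
      have : (Set.range g).ncard ≤ k := by
        rw [← Set.image_univ]
        exact (Set.ncard_image_le Set.finite_univ).trans (by simp)
      exact_mod_cast this
    have hk : (n : ℕ∞) ≤ (B.card + k : ℕ) := hB.trans (by push_cast; gcongr)
    have hk' : n ≤ B.card + k := by exact_mod_cast hk
    obtain ⟨B', hB', hcard⟩ := Finset.exists_subset_card_eq (show n - k ≤ B.card by omega)
    exact ⟨B', hcard, fun p hp hps => hBq p hp fun a ha => (hps a ha).trans hB'⟩

theorem exists_generic_pencil (hm : 1 ≤ m) (S : Finset ℂ) (hS : (m : ℝ) * VF f + 1 ≤ S.card) :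
    ∀ k ≤ n, ∃ ε : Fin k → ℂ, (∀ i, ε i ∈ S) ∧
      (∀ q ∈ extraneousPrimes f (fun i => pencil f (ε i)), (k : ℕ∞) ≤ q.height) ∧
      ∀ r e, HilbertGrowth (newtonFiltration f)
          (sInf (extraneousPrimes f fun i => pencil f (ε i))) r e →
        HilbertGrowth (newtonFiltration f) ⊥ r (e + k) := by
  intro k
  induction k with
  | zero =>
    refine fun _ => ⟨Fin.elim0, fun i => i.elim0, fun _ _ => by simp, fun r e ⟨c, hc⟩ => ?_⟩
    exact ⟨c, fun d => (hc d).trans (hilbertFun_mono (finite_newtonFiltration f) bot_le _)⟩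
  | succ k ih =>
    intro hk
    obtain ⟨ε, hεS, hht, hgrow⟩ := ih (by omega)
    set P := extraneousPrimes f fun i => pencil f (ε i) with hPdef
    have hfin : P.Finite := finite_extraneousPrimes f _
    have hprime : ∀ q ∈ P, q.IsPrime := fun q hq => hq.1.1.1
    have hcard : (P.ncard : ℝ) ≤ VF f := by
      have h := hgrow _ _ (HilbertGrowth.extraneousPrimes f _)
      rw [Nat.sub_add_cancel (by omega)] at h
      exact h.le_VF
    have hlt : P.ncard * (m - 1) < S.card := by
      have h1 : ((P.ncard * (m - 1) : ℕ) : ℝ) < S.card := by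
        refine lt_of_lt_of_le ?_ hS
        push_cast [hm]
        have : (P.ncard : ℝ) * m ≤ VF f * m := by gcongr
        have h0 : (0 : ℝ) ≤ P.ncard := by positivity
        linarith
      exact_mod_cast h1
    obtain ⟨t, htS, ht⟩ := exists_pencil_notMem f hm hfin.toFinset
      (fun q hq => hprime q (hfin.mem_toFinset.mp hq))
      (fun q hq => (hfin.mem_toFinset.mp hq).2) S
      (by rwa [← Set.ncard_eq_toFinset_card _ hfin])
    simp only [Set.Finite.mem_toFinset] at ht
    let ε' : Fin (k + 1) → ℂ := Fin.snoc ε t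
    have hrange : Set.range (fun i => pencil f (ε' i)) =
        insert (pencil f t) (Set.range fun i => pencil f (ε i)) := by
      ext x
      simp [ε', Fin.exists_fin_succ', or_comm, eq_comm]
    have hbelow : ∀ q' ∈ extraneousPrimes f (fun i => pencil f (ε' i)),
        pencil f t ∈ q' ∧ ∃ q ∈ P, q ≤ q' := by
      rintro q' ⟨hq', hq'f⟩
      have hprime' := hq'.1.1
      have hle := hq'.1.2
      rw [hrange, Ideal.span_le, Set.insert_subset_iff] at hle
      obtain ⟨q, hq, hqq'⟩ := Ideal.exists_minimalPrimes_le (Ideal.span_le.mpr hle.2)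
      exact ⟨hle.1, q, ⟨hq, fun h => hq'f (h.trans hqq')⟩, hqq'⟩
    refine ⟨ε', ?_, ?_, ?_⟩
    · intro i
      refine Fin.lastCases ?_ (fun j => ?_) i
      · simpa [ε'] using htS
      · simpa [ε'] using hεS j
    · intro q' hq'
      obtain ⟨hmem, q, hq, hle⟩ := hbelow q' hq'
      have := hprime q hq
      have := hq'.1.1.1
      have hlt : q < q' := lt_of_le_of_ne hle fun h => ht q hq (h ▸ hmem)
      refine le_trans ?_ (Ideal.height_add_one_le_of_lt_of_isPrime hlt)
      push_cast
      gcongr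
      exact hht q hq
    · intro r e h
      rw [show e + (k + 1) = e + 1 + k by ring]
      refine hgrow r (e + 1) (h.of_nonZeroDivisor (finite_newtonFiltration f) ?_ ?_ ?_ ?_
        (g := pencil f t))
      · refine le_sInf fun q' hq' => ?_
        obtain ⟨-, q, hq, hle⟩ := hbelow q' hq'
        exact (sInf_le hq).trans hle
      · intro d p hp
        rw [add_comm]
        exact mul_mem_newtonFiltration f 1 d _ (pencil_mem_newtonFiltration f t) _ hp
      · exact Submodule.mem_sInf.mpr fun q' hq' => (hbelow q' hq').1
      · intro p hp
        refine Submodule.mem_sInf.mpr fun q hq => ?_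
        exact ((hprime q hq).mem_or_mem (Submodule.mem_sInf.mp hp q hq)).resolve_left (ht q hq)

end pencil

section Zariski

open MvPolynomial

variable {n : ℕ}

theorem ZarIrred.isPrime_vanishingIdeal {W : Set (Fin n → ℂ)} (hW : ZarIrred n W) :
    (vanishingIdeal ℂ W).IsPrime := by
  refine Ideal.isPrime_iff.mpr ⟨fun h => ?_, fun {a b} hab => ?_⟩
  · obtain ⟨x, hx⟩ := hW.1
    have := mem_vanishingIdeal_iff.mp ((Ideal.eq_top_iff_one _).mp h) x hx
    simp at this
  · refine (hW.2 {x | ∀ g ∈ ({a} : Set _), eval x g = 0} {x | ∀ g ∈ ({b} : Set _), eval x g = 0}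
      ⟨_, rfl⟩ ⟨_, rfl⟩ fun x hx => ?_).imp (fun h x hx => ?_) fun h x hx => ?_
    · have := hab x hx
      simpa [aeval_eq_eval] using this
    · simpa [aeval_eq_eval] using h hx
    · simpa [aeval_eq_eval] using h hx

theorem zarIrred_zeroLocus (q : Ideal (MvPolynomial (Fin n) ℂ)) [hq : q.IsPrime] :
    ZarIrred n (zeroLocus ℂ q) := by
  have hv := IsPrime.vanishingIdeal_zeroLocus (K := ℂ) q
  refine ⟨?_, ?_⟩
  · rw [Set.nonempty_iff_ne_empty]
    intro h
    rw [h, vanishingIdeal_empty] at hv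
    exact hq.ne_top hv.symm
  · rintro _ _ ⟨T₁, rfl⟩ ⟨T₂, rfl⟩ hsub
    by_contra! h
    obtain ⟨⟨x, hx, hx'⟩, ⟨y, hy, hy'⟩⟩ :=
      And.intro (Set.not_subset.mp h.1) (Set.not_subset.mp h.2)
    simp only [Set.mem_ofPred_eq, not_forall] at hx' hy'
    obtain ⟨a, ha, hax⟩ := hx'
    obtain ⟨b, hb, hby⟩ := hy'
    have hab : a * b ∈ q := by
      rw [← hv]
      intro z hz
      rcases hsub hz with h | h
      · simp [aeval_eq_eval, h a ha]
      · simp [aeval_eq_eval, h b hb]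
    rcases hq.mem_or_mem hab with h | h
    · exact hax (by simpa [aeval_eq_eval] using hx a h)
    · exact hby (by simpa [aeval_eq_eval] using hy b h)

theorem zarClosed_zeroLocus (I : Ideal (MvPolynomial (Fin n) ℂ)) :
    ZarClosed n (zeroLocus ℂ I) :=
  ⟨I, by ext; simp [aeval_eq_eval]⟩

theorem zeroLocus_span_range {ι : Type*} (g : ι → MvPolynomial (Fin n) ℂ) :
    zeroLocus ℂ (Ideal.span (Set.range g)) = {x | ∀ i, eval x (g i) = 0} := by
  rw [zeroLocus_span]
  ext
  simp [aeval_eq_eval]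

theorem IsIrredCompOf.exists_minimalPrimes {W : Set (Fin n → ℂ)}
    {I : Ideal (MvPolynomial (Fin n) ℂ)} (hW : IsIrredCompOf n W (zeroLocus ℂ I)) :
    ∃ q ∈ I.minimalPrimes, W = zeroLocus ℂ q := by
  obtain ⟨hsub, hirr, -, hmax⟩ := hW
  have := hirr.isPrime_vanishingIdeal
  obtain ⟨q, hq, hle⟩ :=
    Ideal.exists_minimalPrimes_le (le_zeroLocus_iff_le_vanishingIdeal.mp hsub)
  have := hq.1.1
  have hqI : zeroLocus ℂ q ⊆ zeroLocus ℂ I := zeroLocus_anti_mono hq.1.2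
  refine ⟨q, hq, hmax _ hqI (zarIrred_zeroLocus q) ⟨_, zarClosed_zeroLocus q, ?_⟩
    (le_zeroLocus_iff_le_vanishingIdeal.mpr hle)⟩
  exact (Set.inter_eq_left.mpr hqI).symm

theorem IsIrredCompOf.of_subset {W Z Z' : Set (Fin n → ℂ)} (hW : IsIrredCompOf n W Z)
    (hWZ' : W ⊆ Z') (hZ : Z' ⊆ Z) (hZ' : ZarClosed n Z') : IsIrredCompOf n W Z' := by
  obtain ⟨-, hirr, ⟨C, hC, hWC⟩, hmax⟩ := hW
  refine ⟨hWZ', hirr, ⟨C, hC, ?_⟩, ?_⟩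
  · refine Set.Subset.antisymm (Set.subset_inter (hWC ▸ Set.inter_subset_left) hWZ') ?_
    calc C ∩ Z' ⊆ C ∩ Z := Set.inter_subset_inter_right _ hZ
      _ = W := hWC.symm
  · rintro W' hW' hirr' ⟨C', ⟨T, hT⟩, hWC'⟩ hle
    obtain ⟨T', hT'⟩ := hZ'
    refine hmax W' (hW'.trans hZ) hirr' ⟨C' ∩ Z', ⟨T ∪ T', ?_⟩, ?_⟩ hle
    · rw [hT, hT']
      ext x
      simp only [Set.mem_inter_iff, Set.mem_ofPred_eq, Set.mem_union]
      exact ⟨fun h g hg => hg.elim (h.1 g) (h.2 g),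
        fun h => ⟨fun g hg => h g (Or.inl hg), fun g hg => h g (Or.inr hg)⟩⟩
    · rw [Set.inter_assoc, Set.inter_eq_left.mpr hZ, hWC']

theorem zeroLocus_eq_singleton_of_le_height (q : Ideal (MvPolynomial (Fin n) ℂ)) [q.IsPrime]
    (hq : (n : ℕ∞) ≤ q.height) : ∃ z, zeroLocus ℂ q = {z} := by
  obtain ⟨M, hM, hle⟩ := Ideal.exists_le_maximal q (Ideal.IsPrime.ne_top ‹_›)
  have hqM : q = M := by
    by_contra hne
    have h1 := Ideal.height_add_one_le_of_lt_of_isPrime (lt_of_le_of_ne hle hne)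
    have h2 := Ideal.height_le_ringKrullDim_of_ne_top hM.ne_top
    rw [MvPolynomial.ringKrullDim_of_isNoetherianRing, ringKrullDim_eq_zero_of_field, zero_add,
      Nat.card_eq_fintype_card, Fintype.card_fin] at h2
    have h3 : M.height ≤ (n : ℕ∞) := by exact_mod_cast h2
    have h4 : (n : ℕ∞) + 1 ≤ n := le_trans (by gcongr) (h1.trans h3)
    have h5 : n + 1 ≤ n := by exact_mod_cast h4
    omega
  obtain ⟨z, hz⟩ := isMaximal_iff_eq_vanishingIdeal_singleton.mp hM
  refine ⟨z, Set.Subset.antisymm (fun x hx => ?_) ?_⟩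
  · ext i
    have h1 : (X i - C (z i) : MvPolynomial (Fin n) ℂ) ∈ q := by
      rw [hqM, hz]
      simp
    simpa [sub_eq_zero] using hx _ h1
  · exact le_zeroLocus_iff_le_vanishingIdeal.mpr (by rw [hqM, hz])

end Zariski

theorem stmt11 (n m : ℕ) (hn : 1 ≤ n) (hm : 1 ≤ m)
    (f : Fin m → MvPolynomial (Fin n) ℂ)
    (S : Finset ℂ) (hS : (m : ℝ) * VF f + 1 ≤ S.card) :
    ∃ ε : Fin n → ℂ, (∀ i, ε i ∈ S) ∧
      ∀ W : Set (Fin n → ℂ),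
        IsIrredCompOf n W {x | ∀ i : Fin n,
          MvPolynomial.eval x (∑ j : Fin m, MvPolynomial.C (ε i ^ (j : ℕ)) * f j) = 0} →
        (IsIrredCompOf n W {x | ∀ i : Fin m, MvPolynomial.eval x (f i) = 0} ∨
          ∃ z : Fin n → ℂ, W = {z}) := by
  obtain ⟨ε, hεS, hht, -⟩ := exists_generic_pencil f hm S hS n le_rfl
  refine ⟨ε, hεS, fun W hW => ?_⟩
  have hle : Ideal.span (Set.range fun i => pencil f (ε i)) ≤ Ideal.span (Set.range f) := by
    rw [Ideal.span_le]
    rintro _ ⟨i, rfl⟩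
    exact Ideal.sum_mem _ fun j _ => Ideal.mul_mem_left _ _ (Ideal.subset_span ⟨j, rfl⟩)
  change IsIrredCompOf n W {x | ∀ i, MvPolynomial.eval x (pencil f (ε i)) = 0} at hW
  rw [← zeroLocus_span_range fun i => pencil f (ε i)] at hW
  rw [← zeroLocus_span_range f]
  obtain ⟨q, hq, rfl⟩ := hW.exists_minimalPrimes
  have := hq.1.1
  by_cases hfq : Ideal.span (Set.range f) ≤ q
  · exact Or.inl (hW.of_subset (MvPolynomial.zeroLocus_anti_mono hfq)
      (MvPolynomial.zeroLocus_anti_mono hle) (zarClosed_zeroLocus _))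
  · exact Or.inr (zeroLocus_eq_singleton_of_le_height q (hht q ⟨hq, hfq⟩))
end

section
/- Let g₁,…,g_s ∈ ℂ[x₁,…,xₙ, w₁,…,w_k, v₁,…,v_r], and for w ∈ ℂᵏ and v ∈ ℂʳ say that G(w,v) holds if there exists x ∈ ℂⁿ with g_i(x,w,v) = 0 for all i = 1,…,s. Then there exists a sequence v(1),…,v(2k+1) ∈ ℂʳ such that for every w ∈ ℂᵏ the following equivalence holds: G(w,v(j)) is true for at least k+1 of the indices j ∈ {1,…,2k+1} if and only if the set {v ∈ ℂʳ : G(w,v) holds} contains a nonempty Zariski-open subset of ℂʳ. -/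
/-- A subset of `ℂʳ` is Zariski open iff it is the complement of the common zero
set of a collection of polynomials. -/
def ZarOpen (r : ℕ) (U : Set (Fin r → ℂ)) : Prop :=
  ∃ T : Set (MvPolynomial (Fin r) ℂ), U = {v | ∃ g ∈ T, MvPolynomial.eval v g ≠ 0}

open MvPolynomial
open scoped TensorProduct
universe u u₁ u₂ u₃ u₄

theorem exists_ringHom_comp_eq_of_nontrivial_tensorProduct {R : Type u₁} {κ : Type u₂}
    {F : Type u₃} {A : Type u₄} [CommRing R] [Field κ]
    [Algebra R κ] [Field F] [CommRing A] [Algebra R A] (ρ : κ →+* F)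
    (h : Nontrivial (κ ⊗[R] A)) :
    ∃ (B : Type (max u₂ u₃ u₄)) (_ : CommRing B) (_ : Nontrivial B) (ψ : F →+* B) (θ : A →+* B),
      θ.comp (algebraMap R A) = ψ.comp (ρ.comp (algebraMap R κ)) := by
  let := ρ.toAlgebra
  refine ⟨F ⊗[κ] (κ ⊗[R] A), inferInstance, inferInstance, algebraMap F _,
    (Algebra.TensorProduct.includeRight : κ ⊗[R] A →ₐ[κ] F ⊗[κ] (κ ⊗[R] A)).toRingHom.comp
      (Algebra.TensorProduct.includeRight : A →ₐ[R] κ ⊗[R] A).toRingHom, ?_⟩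
  ext r
  have h1 : (Algebra.TensorProduct.includeRight : A →ₐ[R] κ ⊗[R] A) (algebraMap R A r) =
      algebraMap κ (κ ⊗[R] A) (algebraMap R κ r) := by
    rw [AlgHom.commutes, ← IsScalarTower.algebraMap_apply]
  simp only [RingHom.comp_apply, AlgHom.toRingHom_eq_coe, RingHom.coe_coe, h1]
  rw [AlgHom.commutes]
  rfl

theorem exists_forall_eval₂_eq_zero_of_mem_range_comap {R F σ ι : Type*} [CommRing R] [Field F]
    [IsAlgClosed F] [Finite σ] (f : ι → MvPolynomial σ R) (φ : R →+* F)
    (h : (⟨RingHom.ker φ, RingHom.ker_isPrime φ⟩ : PrimeSpectrum R) ∈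
      Set.range (PrimeSpectrum.comap
        (algebraMap R (MvPolynomial σ R ⧸ Ideal.span (Set.range f))))) :
    ∃ x : σ → F, ∀ i, eval₂ φ x (f i) = 0 := by
  rw [← PrimeSpectrum.nontrivial_iff_mem_rangeComap] at h
  have hp : (RingHom.ker φ).IsPrime := RingHom.ker_isPrime φ
  have hu : (RingHom.ker φ).primeCompl ≤ (IsUnit.submonoid F).comap φ :=
    fun x hx ↦ IsUnit.mk0 (φ x) hx
  obtain ⟨B, _, _, ψ, θ, hθ⟩ := exists_ringHom_comp_eq_of_nontrivial_tensorProduct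
    (R := R) (κ := (RingHom.ker φ).ResidueField)
    (A := MvPolynomial σ R ⧸ Ideal.span (Set.range f))
    (Ideal.ResidueField.lift (RingHom.ker φ) φ le_rfl hu) h
  have hlift : (Ideal.ResidueField.lift (RingHom.ker φ) φ le_rfl hu).comp (algebraMap R _) = φ := by
    ext r; simp
  rw [hlift] at hθ
  let J : Ideal (MvPolynomial σ F) := Ideal.span (Set.range fun i ↦ map φ (f i))
  have hJ : J ≠ ⊤ := by
    let y : σ → B := fun i ↦ θ (Ideal.Quotient.mk _ (X i))
    suffices J ≤ RingHom.ker (eval₂Hom ψ y) from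
      fun h ↦ RingHom.ker_ne_top _ (top_le_iff.mp (h ▸ this))
    rw [Ideal.span_le]
    rintro _ ⟨i, rfl⟩
    have h2 : eval₂Hom (ψ.comp φ) y = θ.comp (Ideal.Quotient.mk (Ideal.span (Set.range f))) := by
      ext r
      · simpa using! congr($hθ.symm r)
      · simp [y]
    have hmem : f i ∈ Ideal.span (Set.range f) := Ideal.subset_span ⟨i, rfl⟩
    have h3 := congr($h2 (f i))
    rw [RingHom.comp_apply, Ideal.Quotient.eq_zero_iff_mem.mpr hmem, map_zero] at h3
    simpa [eval₂_map] using h3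
  obtain ⟨m, hm, hJm⟩ := Ideal.exists_le_maximal J hJ
  obtain ⟨x, rfl⟩ := eq_vanishingIdeal_singleton_of_isMaximal F hm
  refine ⟨x, fun i ↦ ?_⟩
  have hmem : map φ (f i) ∈ J := Ideal.subset_span ⟨i, rfl⟩
  have := (mem_vanishingIdeal_singleton_iff x _).mp (hJm hmem)
  simpa [aeval_def, eval₂_map] using this

theorem PrimeSpectrum.exists_basicOpen_le_of_isConstructible {R : Type*} [CommRing R] [IsDomain R]
    {s : Set (PrimeSpectrum R)} (hs : Topology.IsConstructible s) (h : ⊥ ∈ s) :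
    ∃ d : R, d ≠ 0 ∧ (PrimeSpectrum.basicOpen d : Set (PrimeSpectrum R)) ⊆ s := by
  obtain ⟨S, rfl⟩ := PrimeSpectrum.exists_constructibleSetData_iff.mpr hs
  simp only [ConstructibleSetData.toSet, Set.mem_iUnion] at h
  obtain ⟨C, hC, hg, hf⟩ := h
  refine ⟨C.f, fun h ↦ hf (by simp [h]), fun p hp ↦ Set.mem_biUnion hC ⟨?_, ?_⟩⟩
  · have hg : ∀ i, C.g i = 0 := by simpa [mem_zeroLocus, Set.range_subset_iff] using! hg
    rintro _ ⟨i, rfl⟩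
    simp [hg]
  · simpa using hp

theorem exists_ne_zero_forall_exists_or_forall_not_exists {R F σ ι : Type*} [CommRing R]
    [IsDomain R] [Field F] [IsAlgClosed F] [Finite σ] [Finite ι] (f : ι → MvPolynomial σ R) :
    ∃ d : R, d ≠ 0 ∧
      ((∀ φ : R →+* F, φ d ≠ 0 → ∃ x : σ → F, ∀ i, eval₂ φ x (f i) = 0) ∨
        ∀ φ : R →+* F, φ d ≠ 0 → ¬ ∃ x : σ → F, ∀ i, eval₂ φ x (f i) = 0) := by
  let I := Ideal.span (Set.range f)
  by_cases hI : Function.Injective (algebraMap R (MvPolynomial σ R ⧸ I))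
  · have : Algebra.FinitePresentation R (MvPolynomial σ R ⧸ I) :=
      .quotient ⟨(Set.finite_range f).toFinset, by simp [I]⟩
    have hc := PrimeSpectrum.isConstructible_range_comap
      (RingHom.finitePresentation_algebraMap.mpr this)
    have hbot : ⊥ ∈ Set.range (PrimeSpectrum.comap (algebraMap R (MvPolynomial σ R ⧸ I))) := by
      rw [PrimeSpectrum.mem_range_comap_iff]
      simpa [← RingHom.ker_eq_comap_bot] using (RingHom.injective_iff_ker_eq_bot _).mp hI
    obtain ⟨d, hd, hdI⟩ := PrimeSpectrum.exists_basicOpen_le_of_isConstructible hc hbot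
    refine ⟨d, hd, .inl fun φ hφ ↦ exists_forall_eval₂_eq_zero_of_mem_range_comap f φ (hdI ?_)⟩
    simpa using! hφ
  · rw [injective_iff_map_eq_zero] at hI
    push Not at hI
    obtain ⟨d, hdI, hd⟩ := hI
    refine ⟨d, hd, .inr fun φ hφ ⟨x, hx⟩ ↦ hφ ?_⟩
    have : I ≤ RingHom.ker (eval₂Hom φ x) := by
      rw [Ideal.span_le]
      rintro _ ⟨i, rfl⟩
      exact hx i
    have hC : (C d : MvPolynomial σ R) ∈ I := Ideal.Quotient.eq_zero_iff_mem.mp hdI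
    simpa using this hC


theorem exists_algebraicIndependent_of_countable {K F : Type u} [CommRing K] [Countable K] [Field F]
    [IsAlgClosed F] [Algebra K F] [FaithfulSMul K F] [Uncountable F] (ι : Type*) [Finite ι] :
    ∃ x : ι → F, AlgebraicIndependent K x := by
  have : Nontrivial K := (algebraMap K F).domain_nontrivial
  obtain ⟨s, hs⟩ := exists_isTranscendenceBasis K F
  have hinf : Infinite s := by
    rw [Cardinal.infinite_iff, ← IsAlgClosed.cardinal_eq_cardinal_transcendence_basis_of_aleph0_lt'
      _ hs Cardinal.mk_le_aleph0 (Cardinal.aleph0_lt_mk_iff.mpr ‹_›)]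
    exact (Cardinal.aleph0_lt_mk_iff.mpr ‹_›).le
  obtain ⟨n, ⟨e⟩⟩ := Finite.exists_equiv_fin ι
  exact ⟨_, hs.1.comp _
    ((e.toEmbedding.trans Fin.valEmbedding).trans (Infinite.natEmbedding s)).injective⟩

theorem AlgebraicIndependent.exists_subalgebra_algebraicIndepOn {K A ι : Type*} [CommRing K]
    [CommRing A] [IsDomain A] [Algebra K A] [Finite ι] {x : ι → A}
    (hx : AlgebraicIndependent K x) (W : Set A) (hW : W.Finite) :
    ∃ (L : Subalgebra K A) (T : Set ι), W ⊆ L ∧ Tᶜ.ncard ≤ W.ncard ∧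
      AlgebraicIndepOn L x T := by
  have : FaithfulSMul K A :=
    (faithfulSMul_iff_algebraMap_injective K A).mpr hx.algebraMap_injective
  have : Nontrivial K := (algebraMap K A).domain_nontrivial
  have hinj : Function.Injective x := hx.injective
  have hV : (Set.range x).Finite := Set.finite_range x
  let M := AlgebraicIndependent.matroid K A
  obtain ⟨I, hI⟩ := M.exists_isBasis W
  have hIW := hI.subset
  obtain ⟨J, hJ, hIJ⟩ := hI.indep.subset_isBasis_of_subset
    (hIW.trans (Set.subset_union_left (t := Set.range x)))
  have hJW : J ∩ W ⊆ I := by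
    have := hI.eq_of_subset_indep (hJ.indep.subset Set.inter_subset_left)
      (Set.subset_inter hIJ hIW) Set.inter_subset_right
    exact this.symm.subset
  have hIind : AlgebraicIndepOn K id I := hI.indep
  have hJind : AlgebraicIndepOn K id J := hJ.indep
  have hJfin : J.Finite := (hW.union hV).subset hJ.subset
  have hcard : (Set.range x).ncard ≤ J.ncard := by
    obtain ⟨V, hVb, hVJ⟩ := (show M.Indep (Set.range x) from
      hx.coe_range).subset_isBasis_of_subset (Set.subset_union_right (s := W))
    have := hVb.encard_eq_encard hJ
    rw [← hJfin.cast_ncard_eq, ← ((hW.union hV).subset hVb.subset).cast_ncard_eq] at this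
    rw [← Nat.cast_inj (R := ℕ∞).mp this]
    exact Set.ncard_le_ncard hVJ ((hW.union hV).subset hVb.subset)
  let S := Algebra.adjoin K I
  let L := (Subalgebra.algebraicClosure S A).restrictScalars K
  have key : AlgebraicIndepOn S (id : A → A) (J \ I) := by
    have h := ((AlgebraicIndependent.iff_adjoin_image (x := ((↑) : J → A)) ((↑) ⁻¹' I)).mp hJind).2
    rw [Subtype.image_preimage_coe, Set.inter_eq_right.mpr hIJ] at h
    exact h.comp (fun a : ↥(J \ I) ↦ ⟨⟨a, a.2.1⟩, a.2.2⟩) fun a b h ↦ by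
      simpa [Subtype.ext_iff] using! h
  refine ⟨L, x ⁻¹' (J \ I), ?_, ?_, ?_⟩
  · intro a ha
    exact (AlgebraicIndependent.matroid_isBasis_iff.mp hI).2.2 a ha
  · have h1 : J \ I ⊆ Set.range x := by
      intro a ha
      exact (hJ.subset ha.1).resolve_left fun h ↦ ha.2 (hJW ⟨ha.1, h⟩)
    have h2 : (x ⁻¹' (J \ I)).ncard = (J \ I).ncard :=
      Set.ncard_preimage_of_injective_subset_range hinj h1
    have h3 := Set.ncard_add_ncard_compl (x ⁻¹' (J \ I))
    have h4 := Set.ncard_sdiff_add_ncard_of_subset hIJ hJfin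
    have h5 := Set.ncard_le_ncard hIW hW
    have h6 : (Set.range x).ncard = Nat.card ι := by
      rw [← Set.image_univ, Set.ncard_image_of_injective _ hinj, Set.ncard_univ]
    omega
  · have := key.subalgebraAlgebraicClosure
    exact this.comp (fun i : ↥(x ⁻¹' (J \ I)) ↦ (⟨x i, i.2⟩ : ↥(J \ I)))
      (fun i j h ↦ Subtype.ext (hinj congr(($h).1)))


theorem countable_adjoin_int {K : Type*} [CommRing K] {S : Set K} (h : S.Countable) :
    Countable (Algebra.adjoin ℤ S) := by
  have := h.to_subtype
  rw [← Cardinal.mk_le_aleph0_iff]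
  have := Algebra.lift_cardinalMk_adjoin_le ℤ S
  simpa using this

theorem exists_ne_zero_forall_exists_aeval_eq_zero_or {L F σ τ ι : Type*} [CommRing L] [IsDomain L]
    [Field F] [IsAlgClosed F] [Algebra L F] [Finite σ] [Finite ι]
    (f : ι → MvPolynomial (σ ⊕ τ) L) :
    ∃ d : MvPolynomial τ L, d ≠ 0 ∧
      ((∀ v : τ → F, aeval v d ≠ 0 → ∃ x : σ → F, ∀ i, aeval (Sum.elim x v) (f i) = 0) ∨
        ∀ v : τ → F, aeval v d ≠ 0 → ¬ ∃ x : σ → F, ∀ i, aeval (Sum.elim x v) (f i) = 0) := by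
  obtain ⟨d, hd, h⟩ := exists_ne_zero_forall_exists_or_forall_not_exists (F := F)
    fun i ↦ sumAlgEquiv L σ τ (f i)
  have key (x : σ → F) (v : τ → F) (p : MvPolynomial (σ ⊕ τ) L) :
      eval₂ (aeval v : MvPolynomial τ L →ₐ[L] F).toRingHom x (sumAlgEquiv L σ τ p) =
        aeval (Sum.elim x v) p := by
    have : (eval₂Hom (aeval v : MvPolynomial τ L →ₐ[L] F).toRingHom x).comp
        (sumAlgEquiv L σ τ : MvPolynomial (σ ⊕ τ) L ≃ₐ[L] _).toRingEquiv.toRingHom =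
        (aeval (Sum.elim x v) : MvPolynomial (σ ⊕ τ) L →ₐ[L] F).toRingHom := by
      ext i
      · simp
      · cases i <;> simp
    exact congr($this p)
  refine ⟨d, hd, h.imp (fun h v hv ↦ ?_) fun h v hv ↦ ?_⟩
  all_goals simpa only [key] using h (aeval v : MvPolynomial τ L →ₐ[L] F).toRingHom hv

theorem exists_eval_ne_zero {R σ : Type*} [CommRing R] [IsDomain R] [Infinite R]
    {p : MvPolynomial σ R} (hp : p ≠ 0) : ∃ v, eval v p ≠ 0 := by
  contrapose! hp
  exact MvPolynomial.funext fun v ↦ by simp [hp]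

theorem stmt12 (n k r s : ℕ)
    (g : Fin s → MvPolynomial (Fin n ⊕ Fin k ⊕ Fin r) ℂ) :
    ∃ vs : Fin (2 * k + 1) → (Fin r → ℂ),
      ∀ w : Fin k → ℂ,
        ((k + 1 ≤ Nat.card {j : Fin (2 * k + 1) //
            ∃ x : Fin n → ℂ, ∀ i, MvPolynomial.eval (Sum.elim x (Sum.elim w (vs j))) (g i) = 0}) ↔
          ∃ U : Set (Fin r → ℂ), U.Nonempty ∧ ZarOpen r U ∧
            ∀ v ∈ U, ∃ x : Fin n → ℂ,
              ∀ i, MvPolynomial.eval (Sum.elim x (Sum.elim w v)) (g i) = 0) := by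
  let K := Algebra.adjoin ℤ (⋃ i, ((g i).coeffs : Set ℂ))
  have : Countable K := countable_adjoin_int
    (Set.finite_iUnion fun i ↦ (g i).coeffs.finite_toSet).countable
  have hg (i : Fin s) : ∃ p : MvPolynomial (Fin n ⊕ Fin k ⊕ Fin r) K,
      map (algebraMap K ℂ) p = g i := by
    refine mem_range_map_iff_coeffs_subset.mpr fun a ha ↦ ⟨⟨a, ?_⟩, rfl⟩
    exact Algebra.subset_adjoin (Set.mem_iUnion_of_mem i ha)
  choose p hp using hg
  have : Uncountable ℂ :=
    Cardinal.aleph0_lt_mk_iff.mp (by simpa using Cardinal.aleph0_lt_continuum)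
  obtain ⟨V, hV⟩ := exists_algebraicIndependent_of_countable (K := K) (F := ℂ)
    (Fin (2 * k + 1) × Fin r)
  refine ⟨fun j i ↦ V (j, i), fun w ↦ ?_⟩
  obtain ⟨L, T, hwL, hT, hLT⟩ :=
    hV.exists_subalgebra_algebraicIndepOn (Set.range w) (Set.finite_range w)
  let f (i : Fin s) : MvPolynomial (Fin n ⊕ Fin r) L :=
    aeval (Sum.elim (fun a ↦ X (.inl a))
      (Sum.elim (fun b ↦ C ⟨w b, hwL ⟨b, rfl⟩⟩) fun c ↦ X (.inr c))) (p i)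
  have hf (x : Fin n → ℂ) (v : Fin r → ℂ) (i : Fin s) :
      aeval (Sum.elim x v) (f i) = eval (Sum.elim x (Sum.elim w v)) (g i) := by
    rw [← hp, eval_map, ← aeval_def]
    have : ((aeval (Sum.elim x v) : MvPolynomial (Fin n ⊕ Fin r) L →ₐ[L] ℂ).restrictScalars K).comp
        (aeval (Sum.elim (fun a ↦ X (.inl a))
          (Sum.elim (fun b ↦ C ⟨w b, hwL ⟨b, rfl⟩⟩) fun c ↦ X (.inr c)))) =
        (aeval (Sum.elim x (Sum.elim w v)) :
          MvPolynomial (Fin n ⊕ Fin k ⊕ Fin r) K →ₐ[K] ℂ) := by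
      ext (a | b | c)
      · simp
      · simp
      · simp
    exact congr($this (p i))
  obtain ⟨d, hd, h⟩ := exists_ne_zero_forall_exists_aeval_eq_zero_or (F := ℂ) f
  simp only [hf] at h
  let D := map (algebraMap L ℂ) d
  have hD : D ≠ 0 := (map_ne_zero_iff _ (map_injective _ Subtype.val_injective)).mpr hd
  have hDd (v : Fin r → ℂ) : eval v D = aeval v d := by
    rw [eval_map, aeval_def]
  let bad : Set (Fin (2 * k + 1)) := Prod.fst '' Tᶜ
  have hbad : bad.ncard ≤ k :=
    (Set.ncard_image_le (Set.toFinite _)).trans <| hT.trans <| by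
      rw [← Set.image_univ]
      simpa using Set.ncard_image_le (f := w) Set.finite_univ
  have hgood (j : Fin (2 * k + 1)) (hj : j ∉ bad) : aeval (fun i ↦ V (j, i)) d ≠ 0 := by
    have hmem (i : Fin r) : (j, i) ∈ T := by
      by_contra hi
      exact hj ⟨(j, i), hi, rfl⟩
    have hind : AlgebraicIndependent L fun i ↦ V (j, i) :=
      hLT.comp (fun i ↦ (⟨(j, i), hmem i⟩ : T)) fun a b hab ↦ by simpa using hab
    exact (map_ne_zero_iff _ hind).mpr hd
  let P (v : Fin r → ℂ) : Prop :=
    ∃ x : Fin n → ℂ, ∀ i, eval (Sum.elim x (Sum.elim w v)) (g i) = 0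
  change k + 1 ≤ {j | P fun i ↦ V (j, i)}.ncard ↔ ∃ U : Set (Fin r → ℂ), U.Nonempty ∧ ZarOpen r U ∧
    ∀ v ∈ U, P v
  obtain h | h := h
  · refine iff_of_true ?_ ⟨{v | ∃ q ∈ ({D} : Set _), eval v q ≠ 0}, ?_, ⟨_, rfl⟩, ?_⟩
    · have hsub : badᶜ ⊆ {j | P fun i ↦ V (j, i)} := fun j hj ↦ h _ (hgood j hj)
      have h1 := Set.ncard_le_ncard hsub
      have h2 := Set.ncard_add_ncard_compl bad
      rw [Nat.card_fin] at h2
      omega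
    · obtain ⟨v, hv⟩ := exists_eval_ne_zero hD
      exact ⟨v, D, rfl, hv⟩
    · rintro v ⟨_, rfl, hv⟩
      exact h v (hDd v ▸ hv)
  · refine iff_of_false ?_ ?_
    · have hsub : {j | P fun i ↦ V (j, i)} ⊆ bad := fun j hj ↦
        by_contra fun hjb ↦ h _ (hgood j hjb) hj
      have h1 := Set.ncard_le_ncard hsub
      omega
    · rintro ⟨_, ⟨v, hv⟩, ⟨S, rfl⟩, hU⟩
      obtain ⟨q, hq, hqv⟩ := hv
      have hq0 : q ≠ 0 := by
        rintro rfl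
        simp at hqv
      obtain ⟨u, hu⟩ := exists_eval_ne_zero (mul_ne_zero hq0 hD)
      rw [map_mul] at hu
      exact h u (hDd u ▸ right_ne_zero_of_mul hu) (hU u ⟨q, hq, left_ne_zero_of_mul hu⟩)
end

section
/- Let n ≥ 1 and let Q ⊂ ℝⁿ be a compact convex set containing the n+1 points 0, e₁, …, eₙ (the origin and the standard basis vectors). Then the number of lattice points of Q satisfies #(Q ∩ ℤⁿ) ≤ n!·vol(Q) + n, where vol denotes n-dimensional Lebesgue measure. -/
open MeasureTheory

/-- The half-open standard simplex, with the facet opposite to the origin removed. -/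
def cornerSimplex (n : ℕ) : Set (Fin n → ℝ) := {x | (∀ i, 0 ≤ x i) ∧ ∑ i, x i < 1}

/-- The cross-polytope is covered by `2 ^ n` reflected copies of the corner simplex. -/
theorem ofReal_inv_factorial_le_volume_cornerSimplex (n : ℕ) :
    ENNReal.ofReal (1 / n.factorial) ≤ volume (cornerSimplex n) := by
  have hball := volume_sum_rpow_lt_one (Fin n) (p := 1) le_rfl
  simp only [Real.rpow_one, div_one, Fintype.card_fin] at hball
  have hG : Real.Gamma (1 + 1) = 1 := by norm_num
  rw [hG, Real.Gamma_nat_eq_factorial, mul_one] at hball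
  let D : (Fin n → ℤˣ) → (Fin n → ℝ) →ₗ[ℝ] (Fin n → ℝ) :=
    fun ε => Matrix.toLin' (Matrix.diagonal fun i => ((ε i : ℤ) : ℝ))
  have hsub : {x : Fin n → ℝ | ∑ i, |x i| < 1} ⊆ ⋃ ε, D ε '' cornerSimplex n := by
    intro x hx
    refine Set.mem_iUnion.2 ⟨fun i => if 0 ≤ x i then 1 else -1, fun i => |x i|,
      ⟨fun i => abs_nonneg _, hx⟩, ?_⟩
    ext i
    simp only [D, Matrix.toLin'_apply, Matrix.mulVec_diagonal]
    split_ifs with h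
    · simp [abs_of_nonneg h]
    · simp [abs_of_neg (not_le.1 h)]
  have hvol : ∀ ε, volume (D ε '' cornerSimplex n) = volume (cornerSimplex n) := by
    intro ε
    rw [Measure.addHaar_image_linearMap, LinearMap.det_toLin', Matrix.det_diagonal,
      Finset.abs_prod]
    have : ∀ i, |((ε i : ℤ) : ℝ)| = 1 := fun i => by
      rcases Int.units_eq_one_or (ε i) with h | h <;> simp [h]
    simp [this]
  have hle := (measure_mono (μ := volume) hsub).trans (measure_iUnion_fintype_le _ _)
  simp only [hvol, hball, Finset.sum_const, Finset.card_univ, Fintype.card_pi,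
    Fintype.card_units_int, Finset.prod_const, Fintype.card_fin, nsmul_eq_mul] at hle
  rw [div_eq_mul_one_div, ENNReal.ofReal_mul (by positivity), ENNReal.ofReal_pow (by norm_num)]
    at hle
  push_cast at hle
  rw [ENNReal.ofReal_ofNat] at hle
  exact (ENNReal.mul_le_mul_iff_right (by simp) (by simp)).1 hle

/-- A nondegenerate lattice simplex has volume at least `1 / n!`. -/
theorem ofReal_inv_factorial_le_volume_image {n : ℕ} (v : Fin n → ℝ) (w : Fin n → Fin n → ℤ)
    (hw : LinearIndependent ℝ fun i j => (w i j : ℝ)) :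
    ENNReal.ofReal (1 / n.factorial) ≤
      volume ((fun x : Fin n → ℝ => v + ∑ i, x i • fun j => (w i j : ℝ)) '' cornerSimplex n) := by
  let M : Matrix (Fin n) (Fin n) ℤ := Matrix.of w
  have hdet : ((M.det : ℤ) : ℝ) = (M.map (Int.cast : ℤ → ℝ)).det := Int.cast_det M
  have hne : M.det ≠ 0 := by
    intro h
    rw [h, Int.cast_zero] at hdet
    have hu := Matrix.linearIndependent_rows_iff_isUnit.1
      (show LinearIndependent ℝ (M.map (Int.cast : ℤ → ℝ)).row from hw)
    rw [Matrix.isUnit_iff_isUnit_det, ← hdet] at hu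
    exact not_isUnit_zero hu
  have himg : (fun x : Fin n → ℝ => v + ∑ i, x i • fun j => (w i j : ℝ)) '' cornerSimplex n =
      (fun y => v + y) '' (Matrix.toLin' (M.map (Int.cast : ℤ → ℝ)).transpose ''
        cornerSimplex n) := by
    rw [Set.image_image]
    refine Set.image_congr fun x _ => ?_
    ext j
    simp [Matrix.toLin'_apply, Matrix.mulVec, dotProduct, M, mul_comm]
  rw [himg, Set.image_add_left, measure_preimage_add, Measure.addHaar_image_linearMap,
    LinearMap.det_toLin', Matrix.det_transpose, ← hdet]
  refine (ofReal_inv_factorial_le_volume_cornerSimplex n).trans (le_mul_of_one_le_left' ?_)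
  rw [ENNReal.one_le_ofReal]
  exact_mod_cast Int.one_le_abs hne

/-- If a finite spanning set lies in an affine half-space missing the origin, then it lies in such
a half-space whose boundary hyperplane is spanned by points of the set. -/
theorem exists_dual_one_le_span_eq_top {E : Type*} [AddCommGroup E] [Module ℝ E]
    (U : Finset E) (hU : Submodule.span ℝ (U : Set E) = ⊤) (l : Module.Dual ℝ E)
    (hl : ∀ u ∈ U, 1 ≤ l u) :
    ∃ m : Module.Dual ℝ E, (∀ u ∈ U, 1 ≤ m u) ∧
      Submodule.span ℝ {u | u ∈ U ∧ m u = 1} = ⊤ := by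
  classical
  induction hk : (U.filter fun u => l u ≠ 1).card using Nat.strong_induction_on generalizing l with
  | _ k ih =>
  by_cases hspan : Submodule.span ℝ {u | u ∈ U ∧ l u = 1} = ⊤
  · exact ⟨l, hl, hspan⟩
  obtain ⟨h, hne, hker⟩ := Submodule.exists_le_ker_of_lt_top _ (lt_top_iff_ne_top.2 hspan)
  have hzero : ∀ u ∈ U, l u = 1 → h u = 0 := fun u hu h1 =>
    hker (Submodule.subset_span ⟨hu, h1⟩)
  have hex : ∃ u ∈ U, h u ≠ 0 := by
    by_contra! hcon
    exact hne (LinearMap.ext_on hU fun u hu => by simpa using hcon u hu)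
  obtain ⟨h, hzero, u₀, hu₀, hneg⟩ : ∃ h : Module.Dual ℝ E,
      (∀ u ∈ U, l u = 1 → h u = 0) ∧ ∃ u ∈ U, h u < 0 := by
    obtain ⟨u, hu, hu0⟩ := hex
    rcases lt_or_gt_of_ne hu0 with hlt | hgt
    · exact ⟨h, hzero, u, hu, hlt⟩
    · exact ⟨-h, fun x hx h1 => by simp [hzero x hx h1], u, hu, by simpa using hgt⟩
  obtain ⟨p, hp, hmin⟩ := (U.filter fun u => h u < 0).exists_min_image
    (fun u => (l u - 1) / (-h u)) ⟨u₀, by simp [hu₀, hneg]⟩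
  rw [Finset.mem_filter] at hp
  set t := (l p - 1) / (-h p) with ht
  have hp0 : 0 < -h p := by linarith [hp.2]
  have ht0 : 0 ≤ t := div_nonneg (by linarith [hl p hp.1]) hp0.le
  have htp : t * (-h p) = l p - 1 := div_mul_cancel₀ _ hp0.ne'
  refine ih _ ?_ (l + t • h) ?_ rfl
  · rw [← hk]
    refine Finset.card_lt_card (Finset.ssubset_iff_of_subset ?_ |>.2 ⟨p, ?_, ?_⟩)
    · intro u hu
      rw [Finset.mem_filter] at hu ⊢
      refine ⟨hu.1, fun h1 => hu.2 ?_⟩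
      simp [hzero u hu.1 h1, h1]
    · rw [Finset.mem_filter]
      exact ⟨hp.1, fun h1 => hp.2.ne (hzero p hp.1 h1)⟩
    · simp only [Finset.mem_filter, not_and, not_not, LinearMap.add_apply, LinearMap.smul_apply,
        smul_eq_mul]
      intro _
      linarith
  · intro u hu
    simp only [LinearMap.add_apply, LinearMap.smul_apply, smul_eq_mul]
    rcases lt_or_ge (h u) 0 with hlt | hge
    · have := hmin u (by simp [hu, hlt])
      rw [le_div_iff₀ (by linarith)] at this
      linarith
    · linarith [hl u hu, mul_nonneg ht0 hge]

/-- The coordinatewise embedding of the integer lattice into real space. -/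
def intVec {n : ℕ} (x : Fin n → ℤ) : Fin n → ℝ := fun i => (x i : ℝ)

/-- The convex hull of a finite set of lattice points. -/
def latticeHull {n : ℕ} (s : Finset (Fin n → ℤ)) : Set (Fin n → ℝ) :=
  convexHull ℝ (intVec '' (s : Set (Fin n → ℤ)))

theorem volume_latticeHull_ne_top {n : ℕ} (s : Finset (Fin n → ℤ)) :
    volume (latticeHull s) ≠ ⊤ :=
  ((s.finite_toSet.image intVec).isCompact_convexHull ℝ).measure_lt_top.ne

/-- Adding to a lattice polytope a lattice point that is linearly separated from it increases the
volume by at least `1 / n!`. -/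
theorem volume_latticeHull_add_le {n : ℕ} [DecidableEq (Fin n → ℤ)] (s : Finset (Fin n → ℤ))
    (a : Fin n → ℤ)
    (hspan : Submodule.span ℝ ((fun x => intVec (x - a)) '' (s : Set (Fin n → ℤ))) = ⊤)
    (l : Module.Dual ℝ (Fin n → ℝ)) (hl : ∀ x ∈ s, 1 ≤ l (intVec (x - a))) :
    volume (latticeHull s) + ENNReal.ofReal (1 / n.factorial) ≤
      volume (latticeHull (insert a s)) := by
  classical
  obtain ⟨m, hm, hmspan⟩ := exists_dual_one_le_span_eq_top (s.image fun x => intVec (x - a))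
    (by simpa using hspan) l (by simpa using hl)
  have hfin := Submodule.exists_fun_fin_finrank_span_eq ℝ
    {u | u ∈ s.image (fun x => intVec (x - a)) ∧ m u = 1}
  rw [hmspan, finrank_top, Module.finrank_fin_fun] at hfin
  obtain ⟨f, hf, -, hind⟩ := hfin
  have hf' : ∀ i, ∃ x ∈ s, intVec (x - a) = f i := fun i => by simpa using (hf i).1
  choose g hgs hg using hf'
  have hfg : f = fun i j => (((g i - a) j : ℤ) : ℝ) := by
    ext i j
    rw [← hg]
    rfl
  set T := (fun x : Fin n → ℝ => intVec a + ∑ i, x i • f i) '' cornerSimplex n with hT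
  have hvol : ENNReal.ofReal (1 / n.factorial) ≤ volume T := by
    have := ofReal_inv_factorial_le_volume_image (intVec a) (fun i => g i - a) (hfg ▸ hind)
    rw [hT, hfg]
    exact this
  have hsub : ∀ x : Fin n → ℤ, intVec (x - a) = intVec x - intVec a := fun x => by
    ext i
    simp [intVec]
  have hK : ∀ y ∈ latticeHull s, m (intVec a) + 1 ≤ m y := by
    have : latticeHull s ⊆ {y | m (intVec a) + 1 ≤ m y} := by
      refine convexHull_min ?_ (convex_halfSpace_ge m.isLinear _)
      rintro _ ⟨x, hx, rfl⟩
      have := hm _ (Finset.mem_image_of_mem _ hx)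
      rw [hsub, map_sub] at this
      simp only [Set.mem_ofPred_eq]
      linarith
    exact this
  have hTm : ∀ y ∈ T, m y < m (intVec a) + 1 := by
    rintro _ ⟨x, hx, rfl⟩
    simpa [(hf _).2] using hx.2
  have hdisj : Disjoint (latticeHull s) T :=
    Set.disjoint_left.2 fun y hy hy' => absurd (hK y hy) (not_le.2 (hTm y hy'))
  have hconv : Convex ℝ (latticeHull (insert a s)) := convex_convexHull ℝ _
  have hTsub : T ⊆ latticeHull (insert a s) := by
    rintro _ ⟨x, hx, rfl⟩
    have hmem : ∀ y ∈ insert a s, intVec y ∈ latticeHull (insert a s) := fun y hy =>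
      subset_convexHull ℝ _ (Set.mem_image_of_mem _ hy)
    have key := hconv.sum_mem (t := Finset.univ)
      (w := fun o : Option (Fin n) => o.elim (1 - ∑ i, x i) x)
      (z := fun o => o.elim (intVec a) fun i => intVec (g i))
      (by
        rintro (_ | i) _
        · simpa using hx.2.le
        · exact hx.1 i)
      (by simp [Fintype.sum_option])
      (by
        rintro (_ | i) _
        · exact hmem _ (Finset.mem_insert_self _ _)
        · exact hmem _ (Finset.mem_insert_of_mem (hgs i)))
    convert key using 1
    simp only [Fintype.sum_option, Option.elim, ← hg, hsub, smul_sub, Finset.sum_sub_distrib,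
      sub_smul, one_smul, Finset.sum_smul]
    abel
  have hmeas : MeasurableSet (latticeHull s) :=
    ((s.finite_toSet.image intVec).isClosed_convexHull (𝕜 := ℝ)).measurableSet
  calc _ ≤ volume (latticeHull s) + volume T := by gcongr
    _ = volume (latticeHull s ∪ T) := (measure_union' hdisj hmeas).symm
    _ ≤ _ := measure_mono (Set.union_subset
      (convexHull_mono (Set.image_mono (by simp))) hTsub)

/-- A strictly convex function, nonnegative on the lattice, that vanishes exactly at the vertices
of the standard simplex. -/
def latticeHeight {n : ℕ} (x : Fin n → ℤ) : ℤ :=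
  ∑ i, x i * (x i - 1) + (∑ i, x i) * (∑ i, x i - 1)

/-- The vertices of the standard simplex. -/
def simplexVertices (n : ℕ) : Finset (Fin n → ℤ) :=
  Finset.univ.image fun o : Option (Fin n) => o.elim 0 fun i => Pi.single i 1

theorem card_simplexVertices_le (n : ℕ) : (simplexVertices n).card ≤ n + 1 :=
  Finset.card_image_le.trans (by simp)

theorem latticeHeight_eq_zero_of_mem {n : ℕ} {x : Fin n → ℤ} (hx : x ∈ simplexVertices n) :
    latticeHeight x = 0 := by
  obtain ⟨_ | i, -, rfl⟩ := Finset.mem_image.1 hx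
  · simp [latticeHeight]
  · simp [latticeHeight, Pi.single_apply]

theorem Int.mul_sub_one_nonneg (k : ℤ) : 0 ≤ k * (k - 1) := by
  rcases le_or_gt k 0 with h | h <;> nlinarith

theorem mem_simplexVertices_of_latticeHeight_le {n : ℕ} {x : Fin n → ℤ}
    (hx : latticeHeight x ≤ 0) : x ∈ simplexVertices n := by
  have h1 : 0 ≤ ∑ i, x i * (x i - 1) := Finset.sum_nonneg fun i _ => Int.mul_sub_one_nonneg _
  have h2 := Int.mul_sub_one_nonneg (∑ i, x i)
  unfold latticeHeight at hx
  have h01 : ∀ i, x i = 0 ∨ x i = 1 := fun i => by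
    have := (Finset.sum_eq_zero_iff_of_nonneg fun i _ => Int.mul_sub_one_nonneg (x i)).1
      (by linarith) i (Finset.mem_univ i)
    rcases mul_eq_zero.1 this with h | h <;> omega
  have hs : ∑ i, x i ≤ 1 := by nlinarith
  refine Finset.mem_image.2 ?_
  by_cases hzero : ∀ i, x i = 0
  · exact ⟨none, Finset.mem_univ _, funext fun i => (hzero i).symm⟩
  push Not at hzero
  obtain ⟨i, hi⟩ := hzero
  refine ⟨some i, Finset.mem_univ _, funext fun j => ?_⟩
  have hi1 := (h01 i).resolve_left hi
  by_cases hji : j = i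
  · subst hji
    simp [hi1]
  · have := Finset.add_le_sum (f := x) (s := Finset.univ)
      (fun k _ => by rcases h01 k with h | h <;> simp [h])
      (Finset.mem_univ i) (Finset.mem_univ j) (Ne.symm hji)
    have hj := h01 j
    simp only [Option.elim, Pi.single_apply, if_neg hji]
    omega

/-- A sublevel set of `latticeHeight` is separated from any other lattice point at that level. -/
theorem exists_dual_one_le_of_latticeHeight_le {n : ℕ} (a : Fin n → ℤ) :
    ∃ l : Module.Dual ℝ (Fin n → ℝ), ∀ x : Fin n → ℤ, x ≠ a →
      latticeHeight x ≤ latticeHeight a → 1 ≤ l (intVec (x - a)) := by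
  let c : Fin n → ℤ := fun i => -((2 * a i - 1) + (2 * ∑ j, a j - 1))
  refine ⟨∑ i, (c i : ℝ) • LinearMap.proj i, fun x hxa hx => ?_⟩
  have hval : (∑ i, (c i : ℝ) • LinearMap.proj i : Module.Dual ℝ (Fin n → ℝ)) (intVec (x - a)) =
      ((∑ i, c i * (x i - a i) : ℤ) : ℝ) := by
    simp [intVec]
  rw [hval]
  have hid : latticeHeight x - latticeHeight a = -∑ i, c i * (x i - a i) +
      (∑ i, (x i - a i) ^ 2 + (∑ i, (x i - a i)) ^ 2) := by
    have e1 : ∑ i, x i * (x i - 1) - ∑ i, a i * (a i - 1) =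
        ∑ i, (2 * a i - 1) * (x i - a i) + ∑ i, (x i - a i) ^ 2 := by
      rw [← Finset.sum_sub_distrib, ← Finset.sum_add_distrib]
      exact Finset.sum_congr rfl fun i _ => by ring
    have e2 : ∑ i, c i * (x i - a i) =
        -∑ i, (2 * a i - 1) * (x i - a i) - (2 * ∑ j, a j - 1) * ∑ i, (x i - a i) := by
      rw [Finset.mul_sum, ← Finset.sum_neg_distrib, ← Finset.sum_sub_distrib]
      exact Finset.sum_congr rfl fun i _ => by ring
    rw [e2, latticeHeight, latticeHeight, Finset.sum_sub_distrib]
    linear_combination e1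
  obtain ⟨i, hi⟩ := Function.ne_iff.1 hxa
  have hpos : 0 < ∑ i, (x i - a i) ^ 2 :=
    Finset.sum_pos' (fun i _ => sq_nonneg _)
      ⟨i, Finset.mem_univ i, by have := sub_ne_zero.2 hi; positivity⟩
  have hz : 1 ≤ ∑ i, c i * (x i - a i) := by
    linarith [sq_nonneg (∑ i, (x i - a i))]
  exact_mod_cast hz

theorem span_intVec_sub_eq_top {n : ℕ} {s : Finset (Fin n → ℤ)} (hs : simplexVertices n ⊆ s)
    (a : Fin n → ℤ) :
    Submodule.span ℝ ((fun x => intVec (x - a)) '' (s : Set (Fin n → ℤ))) = ⊤ := by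
  rw [eq_top_iff, ← (Pi.basisFun ℝ (Fin n)).span_eq, Submodule.span_le]
  rintro _ ⟨i, rfl⟩
  rw [SetLike.mem_coe]
  have hmem : ∀ o : Option (Fin n), intVec ((o.elim 0 fun i => Pi.single i 1) - a) ∈
      Submodule.span ℝ ((fun x => intVec (x - a)) '' (s : Set (Fin n → ℤ))) := fun o =>
    Submodule.subset_span ⟨_, hs (Finset.mem_image_of_mem _ (Finset.mem_univ o)), rfl⟩
  have := Submodule.sub_mem _ (hmem (some i)) (hmem none)
  convert this using 1
  ext j
  simp [intVec, Pi.single_apply]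

theorem ofReal_inv_factorial_le_volume_latticeHull_simplexVertices (n : ℕ) :
    ENNReal.ofReal (1 / n.factorial) ≤ volume (latticeHull (simplexVertices n)) := by
  refine (ofReal_inv_factorial_le_volume_cornerSimplex n).trans (measure_mono fun x hx => ?_)
  have hconv : Convex ℝ (latticeHull (simplexVertices n)) := convex_convexHull ℝ _
  have key := hconv.sum_mem (t := Finset.univ)
    (w := fun o : Option (Fin n) => o.elim (1 - ∑ i, x i) x)
    (z := fun o => intVec (o.elim 0 fun i => Pi.single i 1))
    (by
      rintro (_ | i) _
      · simpa using hx.2.le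
      · exact hx.1 i)
    (by simp [Fintype.sum_option])
    (fun o _ => subset_convexHull ℝ _
      ⟨_, Finset.mem_image_of_mem _ (Finset.mem_univ o), rfl⟩)
  convert key using 1
  ext j
  simp [Fintype.sum_option, intVec, Pi.single_apply]

/-- Blichfeldt's inequality for the convex hull of a finite set of lattice points. -/
theorem card_le_factorial_mul_volume_latticeHull_add {n : ℕ} (s : Finset (Fin n → ℤ))
    (hs : simplexVertices n ⊆ s) :
    (s.card : ℝ) ≤ n.factorial * (volume (latticeHull s)).toReal + n := by
  classical
  have hfac : (0 : ℝ) < n.factorial := by exact_mod_cast n.factorial_pos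
  induction s using Finset.induction_on_max_value latticeHeight with
  | empty =>
    simp only [Finset.card_empty, Nat.cast_zero]
    positivity
  | insert a s ha hmax ih =>
    by_cases hB : simplexVertices n ⊆ s
    · obtain ⟨l, hl⟩ := exists_dual_one_le_of_latticeHeight_le a
      have hvol := volume_latticeHull_add_le s a (span_intVec_sub_eq_top hB a) l fun x hx =>
        hl x (fun h => ha (h ▸ hx)) (hmax x hx)
      have hreal := ENNReal.toReal_mono (volume_latticeHull_ne_top _) hvol
      rw [ENNReal.toReal_add (volume_latticeHull_ne_top _) ENNReal.ofReal_ne_top,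
        ENNReal.toReal_ofReal (by positivity)] at hreal
      have hmul := mul_le_mul_of_nonneg_left hreal hfac.le
      rw [mul_add, mul_one_div_cancel hfac.ne'] at hmul
      rw [Finset.card_insert_of_notMem ha]
      push_cast
      linarith [ih hB]
    · have haB : a ∈ simplexVertices n := by
        by_contra hcon
        exact hB fun x hx => Finset.mem_of_mem_insert_of_ne (hs hx) fun h => hcon (h ▸ hx)
      have heq : insert a s = simplexVertices n := by
        refine Finset.Subset.antisymm (Finset.insert_subset haB fun x hx => ?_) hs
        exact mem_simplexVertices_of_latticeHeight_le
          ((hmax x hx).trans (latticeHeight_eq_zero_of_mem haB).le)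
      rw [heq]
      have hreal := ENNReal.toReal_mono (volume_latticeHull_ne_top _)
        (ofReal_inv_factorial_le_volume_latticeHull_simplexVertices n)
      rw [ENNReal.toReal_ofReal (by positivity)] at hreal
      have hmul := mul_le_mul_of_nonneg_left hreal hfac.le
      rw [mul_one_div_cancel hfac.ne'] at hmul
      have hcard : ((simplexVertices n).card : ℝ) ≤ n + 1 := by
        exact_mod_cast card_simplexVertices_le n
      linarith

theorem intVec_injective {n : ℕ} : Function.Injective (intVec : (Fin n → ℤ) → Fin n → ℝ) :=
  fun _ _ h => funext fun i => Int.cast_injective (congrFun h i)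

theorem finite_preimage_intVec {n : ℕ} {Q : Set (Fin n → ℝ)} (hQ : Bornology.IsBounded Q) :
    (intVec ⁻¹' Q).Finite := by
  obtain ⟨R, hR⟩ := hQ.exists_norm_le
  refine (Set.finite_Icc (fun _ : Fin n => -⌈R⌉) fun _ => ⌈R⌉).subset fun x hx => ?_
  have h : ∀ i, |x i| ≤ ⌈R⌉ := fun i => by
    have h1 : |(x i : ℝ)| ≤ R := (norm_le_pi_norm (intVec x) i).trans (hR _ hx)
    exact_mod_cast h1.trans (Int.le_ceil R)
  exact ⟨fun i => (abs_le.1 (h i)).1, fun i => (abs_le.1 (h i)).2⟩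

theorem stmt13 (n : ℕ) (hn : 1 ≤ n) (Q : Set (Fin n → ℝ))
    (hconv : Convex ℝ Q) (hcomp : IsCompact Q)
    (h0 : (0 : Fin n → ℝ) ∈ Q) (he : ∀ j : Fin n, Pi.single j (1 : ℝ) ∈ Q)
    (L : Set (Fin n → ℝ))
    (hL : L = {x ∈ Q | ∀ i, ∃ z : ℤ, x i = (z : ℝ)}) :
    L.Finite ∧ (L.ncard : ℝ) ≤ (n.factorial : ℝ) * (volume Q).toReal + n := by
  have hfin := finite_preimage_intVec hcomp.isBounded
  have hL' : L = intVec '' (intVec ⁻¹' Q) := by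
    rw [hL]
    ext x
    constructor
    · rintro ⟨hx, hz⟩
      choose z hz using hz
      have hxz : intVec z = x := funext fun i => (hz i).symm
      exact ⟨z, by rwa [Set.mem_preimage, hxz], hxz⟩
    · rintro ⟨z, hz, rfl⟩
      exact ⟨hz, fun i => ⟨z i, rfl⟩⟩
  refine ⟨hL' ▸ hfin.image _, ?_⟩
  rw [hL', Set.ncard_image_of_injective _ intVec_injective, Set.ncard_eq_toFinset_card _ hfin]
  have hsub : simplexVertices n ⊆ hfin.toFinset := by
    intro x hx
    rw [Set.Finite.mem_toFinset, Set.mem_preimage]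
    obtain ⟨_ | i, -, rfl⟩ := Finset.mem_image.1 hx
    · convert h0 using 1
      ext j
      simp [intVec]
    · convert he i using 1
      ext j
      simp [intVec, Pi.single_apply]
  refine (card_le_factorial_mul_volume_latticeHull_add _ hsub).trans ?_
  have hhull : latticeHull hfin.toFinset ⊆ Q :=
    convexHull_min (by simp) hconv
  gcongr
  exact hcomp.measure_lt_top.ne
end
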